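/- For every ε > 0 there exists a constant K > 0 such that for every finite field F_q of odd order q, every integer n ≥ 2, and every monic polynomial F ∈ F_q[t] of degree n, if q ≥ K·n³·2^(binomial(n+2,2)) then |R(F;q)·n(n−1)/q^(n−1) − 1| < ε. In other words, R(F;q) ∼ q^(n−1)/(n(n−1)) uniformly in F whenever q/(n³·2^(binomial(n+2,2))) → ∞ with q odd. -/

import Mathlib

open Polynomial

section Stepanov

variable {K : Type*} [Field K]

/-- Hasse derivatives of order `l` lower the power of a factor `P ^ c` by at most `l`. -/
lemma pow_sub_dvd_hasseDeriv_pow_mul (P : K[X]) (c : ℕ) :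
    ∀ (l : ℕ) (u : K[X]), P ^ (c - l) ∣ hasseDeriv l (P ^ c * u) := by
  induction c with
  | zero => intro l u; simp
  | succ c ih =>
    intro l u
    rw [pow_succ', mul_assoc, hasseDeriv_mul]
    refine Finset.dvd_sum fun ij hij => ?_
    obtain ⟨i, j⟩ := ij
    have hij' : i + j = l := Finset.HasAntidiagonal.mem_antidiagonal.mp hij
    rcases Nat.eq_zero_or_pos i with rfl | hi
    · obtain rfl : j = l := by omega
      rw [hasseDeriv_zero']
      refine (pow_dvd_pow P (by omega : c + 1 - j ≤ 1 + (c - j))).trans ?_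
      rw [pow_add, pow_one]
      exact mul_dvd_mul_left _ (ih j u)
    · exact ((pow_dvd_pow P (by omega : c + 1 - l ≤ c - j)).trans (ih j u)).mul_left _

/-- The quotient of `hasseDeriv l (P ^ c * u)` by `P ^ (c - l)`, as a linear map in `u`. -/
lemma exists_linearMap_hasseDeriv_pow_mul {P : K[X]} (hP : P ≠ 0) (c l : ℕ) :
    ∃ Φ : K[X] →ₗ[K] K[X], ∀ u, hasseDeriv l (P ^ c * u) = P ^ (c - l) * Φ u := by
  choose w hw using pow_sub_dvd_hasseDeriv_pow_mul P c l
  have hP' : P ^ (c - l) ≠ 0 := pow_ne_zero _ hP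
  refine ⟨⟨⟨w, fun u v => ?_⟩, fun a u => ?_⟩, hw⟩
  · apply mul_left_cancel₀ hP'
    rw [← hw, mul_add, mul_add, ← hw, ← hw, map_add]
  · apply mul_left_cancel₀ hP'
    rw [← hw, mul_smul_comm, map_smul, hw]
    simp

lemma natDegree_le_of_hasseDeriv_pow_mul {P u w : K[X]} {c l : ℕ} (hP : P ≠ 0) (hlc : l ≤ c)
    (h : hasseDeriv l (P ^ c * u) = P ^ (c - l) * w) :
    w.natDegree ≤ u.natDegree + l * P.natDegree := by
  rcases eq_or_ne w 0 with rfl | hw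
  · simp
  have h1 := natDegree_hasseDeriv_le (P ^ c * u) l
  rw [h, natDegree_mul (pow_ne_zero _ hP) hw, natDegree_pow] at h1
  have h2 := natDegree_mul_le (p := P ^ c) (q := u)
  rw [natDegree_pow] at h2
  obtain ⟨d, rfl⟩ := Nat.exists_eq_add_of_le hlc
  rw [Nat.add_sub_cancel_left] at h1
  rw [add_mul] at h2
  omega

/-- Low order Taylor coefficients of `G * X ^ (q * j)`, where `q` is a power of the
characteristic. -/
lemma coeff_taylor_mul_X_pow {q p n : ℕ} [Fact p.Prime] [CharP K p] (hq : q = p ^ n)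
    (G : K[X]) (x : K) (j l : ℕ) (hl : l < q) :
    (taylor x (G * X ^ (q * j))).coeff l = (taylor x G).coeff l * x ^ (q * j) := by
  have h1 : (X + C x : K[X]) ^ q = X ^ q + C (x ^ q) := by
    rw [hq, add_pow_char_pow, C_pow]
  obtain ⟨B, hB⟩ : (X : K[X]) ^ q ∣ (X ^ q + C (x ^ q)) ^ j - C (x ^ q) ^ j := by
    have := sub_dvd_pow_sub_pow (X ^ q + C (x ^ q) : K[X]) (C (x ^ q)) j
    simpa using this
  have h2 : (X ^ q + C (x ^ q) : K[X]) ^ j = C (x ^ (q * j)) + X ^ q * B := by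
    rw [pow_mul, C_pow (a := x ^ q), ← hB]; ring
  rw [taylor_mul, taylor_pow, taylor_X, pow_mul, h1, h2, mul_add, coeff_add, coeff_mul_C,
    show taylor x G * (X ^ q * B) = (taylor x G * B) * X ^ q by ring, coeff_mul_X_pow']
  simp [Nat.not_le.mpr hl]

lemma X_sub_C_pow_dvd_iff_taylor (R : K[X]) (x : K) (M : ℕ) :
    (X - C x) ^ M ∣ R ↔ ∀ l < M, (taylor x R).coeff l = 0 := by
  rw [← X_pow_dvd_iff, ← map_dvd_iff (taylorEquiv x)]
  simp [taylorEquiv, taylor_pow, taylor_X]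

lemma card_mul_le_natDegree {R : K[X]} (hR : R ≠ 0) (T : Finset K) (M : ℕ)
    (h : ∀ x ∈ T, (X - C x) ^ M ∣ R) : M * T.card ≤ R.natDegree := by
  have h1 : ∏ x ∈ T, (X - C x) ^ M ∣ R :=
    Finset.prod_dvd_of_coprime
      (fun x _ y _ hxy => (pairwise_coprime_X_sub_C (s := id) Function.injective_id hxy).pow) h
  have h2 := natDegree_le_of_dvd h1 hR
  rw [natDegree_prod _ _ fun x _ => pow_ne_zero _ (X_sub_C_ne_zero x)] at h2
  simpa [mul_comm] using h2

end Stepanov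

section Stepanov

variable {K : Type*} [Field K]

set_option maxHeartbeats 1000000 in
/-- **Stepanov's bound** for the number of points of a finite field at which the `(q - 1) / 2`-th
power of a polynomial of odd degree takes a given value. -/
theorem stepanov {Fq : Type*} [Field Fq] [Fintype Fq] [Algebra Fq K]
    (hq : Odd (Fintype.card Fq)) {P : K[X]} (hP : Odd P.natDegree)
    (hPq : 2 * P.natDegree ≤ Fintype.card Fq) {t : ℕ} (ht : 1 ≤ t)
    (htq : 32 * t ^ 2 ≤ Fintype.card Fq) (σ : K) (T : Finset Fq)
    (hT : ∀ x ∈ T, (P.eval (algebraMap Fq K x)) ^ ((Fintype.card Fq - 1) / 2) = σ) :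
    2 * t * T.card ≤ Fintype.card Fq * t + 2 * t * P.natDegree
      + 2 * (Fintype.card Fq * P.natDegree) := by
  classical
  have hP0 : P ≠ 0 := by rintro rfl; simp at hP
  obtain ⟨p, hp, n, hpp, hcard⟩ := FiniteField.card' Fq
  have : Fact p.Prime := ⟨hpp⟩
  have : CharP K p := charP_of_injective_algebraMap (algebraMap Fq K).injective p
  set q := Fintype.card Fq with hqdef
  set k := P.natDegree with hk
  set m := (q - 1) / 2 with hm
  set L := (q - k) / 2 with hL
  set M := 2 * t with hM
  set J := t + k with hJ
  set D := L + M * k + J with hD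
  have hm2 : 2 * m + 1 = q := by obtain ⟨a, ha⟩ := hq; omega
  have hL2 : 2 * L + k = q := by obtain ⟨a, ha⟩ := hq; obtain ⟨b, hb⟩ := hP; omega
  have hk1 : 1 ≤ k := hP.pos
  have hMq : M ≤ q := by nlinarith
  choose Φ₀ hΦ₀ using fun l : Fin M => exists_linearMap_hasseDeriv_pow_mul hP0 M l
  choose Φ₁ hΦ₁ using fun l : Fin M => exists_linearMap_hasseDeriv_pow_mul hP0 (M + m) l
  let Q : Fin M → ((Bool × Fin J → degreeLT K L) →ₗ[K] K[X]) := fun l =>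
    ∑ j : Fin J, (LinearMap.mulRight K ((X : K[X]) ^ (j : ℕ))).comp
      ((Φ₀ l).comp ((degreeLT K L).subtype.comp (LinearMap.proj (false, j))) +
        σ • (Φ₁ l).comp ((degreeLT K L).subtype.comp (LinearMap.proj (true, j))))
  have hQ : ∀ l c, Q l c = ∑ j : Fin J,
      (Φ₀ l (c (false, j)) + σ • Φ₁ l (c (true, j))) * X ^ (j : ℕ) := by
    intro l c; simp [Q, LinearMap.sum_apply]
  let Ψ : (Bool × Fin J → degreeLT K L) →ₗ[K] (Fin M → Fin D → K) :=
    LinearMap.pi fun l => LinearMap.pi fun i => (lcoeff K (i : ℕ)).comp (Q l)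
  have : Module.Finite K (degreeLT K L) := Module.Finite.equiv (degreeLTEquiv K L).symm
  have hfin : Module.finrank K (degreeLT K L) = L := by
    rw [(degreeLTEquiv K L).finrank_eq]; simp
  have hker : LinearMap.ker Ψ ≠ ⊥ := by
    apply LinearMap.ker_ne_bot_of_finrank_lt
    simp only [Module.finrank_pi_fintype, hfin, Finset.sum_const, Finset.card_univ,
      Fintype.card_prod, Fintype.card_bool, Fintype.card_fin, smul_eq_mul, Module.finrank_self,
      mul_one]
    have e1 : t * k ≤ t ^ 2 * k := Nat.mul_le_mul_right k (by nlinarith)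
    have e2 : t ^ 2 ≤ t ^ 2 * k := by nlinarith
    have e3 : 32 * (t ^ 2 * k) ≤ q * k := by nlinarith
    have e4 : q * k ≤ 4 * (L * k) := by nlinarith
    have e5 : 1 ≤ t ^ 2 * k := by nlinarith [Nat.mul_le_mul (Nat.one_le_pow 2 t ht) hk1]
    have : M * D = 2 * (t * L) + 4 * (t ^ 2 * k) + 2 * t ^ 2 + 2 * (t * k) := by
      simp only [hM, hD, hJ]; ring
    rw [this]
    have : 2 * J * L = 2 * (t * L) + 2 * (L * k) := by simp only [hJ]; ring
    rw [this]
    omega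
  obtain ⟨c, hc, hc0⟩ := Submodule.exists_mem_ne_zero_of_ne_bot hker
  have hdeg : ∀ i, ((c i : degreeLT K L) : K[X]) ≠ 0 → (c i : K[X]).natDegree < L := fun i hi =>
    (natDegree_lt_iff_degree_lt hi).2 (mem_degreeLT.1 (c i).2)
  have hLpos : 0 < L := by omega
  have hdeg' : ∀ i, (c i : K[X]).natDegree < L := fun i => by
    by_cases hi : (c i : K[X]) = 0
    · rw [hi]; simpa using hLpos
    · exact hdeg i hi
  have hQ0 : ∀ l, Q l c = 0 := by
    intro l
    ext i
    by_cases hi : i < D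
    · have := congrFun (congrFun (LinearMap.mem_ker.1 hc) l) ⟨i, hi⟩
      simpa [Ψ] using this
    · rw [coeff_zero, hQ]
      apply coeff_eq_zero_of_natDegree_lt
      refine lt_of_le_of_lt (natDegree_sum_le_of_forall_le (n := L - 1 + M * k + (J - 1)) _ _ ?_)
        (by omega)
      intro j _
      have b0 := natDegree_le_of_hasseDeriv_pow_mul hP0 l.2.le (hΦ₀ l (c (false, j)))
      have b1 := natDegree_le_of_hasseDeriv_pow_mul hP0 (l.2.le.trans (Nat.le_add_right _ _))
        (hΦ₁ l (c (true, j)))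
      rw [← hk] at b0 b1
      have h0 := hdeg' (false, j)
      have h1 := hdeg' (true, j)
      have h2 : (l : ℕ) * k ≤ M * k := Nat.mul_le_mul_right _ l.2.le
      have h3 := j.2
      refine natDegree_mul_le.trans ?_
      rw [natDegree_X_pow]
      refine Nat.add_le_add ((natDegree_add_le _ _).trans (max_le ?_ ?_)) (by omega)
      · omega
      · exact (natDegree_smul_le _ _).trans (by omega)
  let f : Bool × Fin J → K[X] := fun i =>
    (c i : K[X]) * P ^ (if i.1 then m else 0) * X ^ (q * (i.2 : ℕ))
  have hf0 : ∀ i, f i ≠ 0 → (c i : K[X]) ≠ 0 := fun i hi h => hi (by simp [f, h])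
  have hfdeg : ∀ i, (c i : K[X]) ≠ 0 →
      (f i).natDegree = (c i : K[X]).natDegree + (if i.1 then m else 0) * k + q * i.2 := by
    intro i hi
    simp only [f]
    rw [natDegree_mul (mul_ne_zero hi (pow_ne_zero _ hP0)) (pow_ne_zero _ X_ne_zero),
      natDegree_mul hi (pow_ne_zero _ hP0), natDegree_pow, natDegree_X_pow]
  have hmk : m * k = q * ((k - 1) / 2) + L := by
    obtain ⟨b, hb⟩ := hP
    have h1 : (k - 1) / 2 = b := by omega
    rw [h1]
    have h2 : 2 * (m * k) + k = q * k := by rw [← hm2]; ring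
    have h3 : q * k = 2 * (q * b) + q := by rw [hb]; ring
    omega
  have hS : ∑ i, f i ≠ 0 := by
    obtain ⟨i₀, hi₀⟩ := Function.ne_iff.1 hc0
    have hi₀' : (c i₀ : K[X]) ≠ 0 := fun h => hi₀ (Subtype.ext h)
    have hfi₀ : f i₀ ≠ 0 :=
      mul_ne_zero (mul_ne_zero hi₀' (pow_ne_zero _ hP0)) (pow_ne_zero _ X_ne_zero)
    intro h0
    have := degree_sum_eq_of_disjoint f Finset.univ ?_
    · rw [h0, degree_zero, eq_comm, Finset.sup_eq_bot_iff] at this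
      exact hfi₀ (degree_eq_bot.1 (this i₀ (Finset.mem_univ _)))
    · rintro i ⟨-, hi⟩ i' ⟨-, hi'⟩ hne heq
      apply hne
      have hnd : (f i).natDegree = (f i').natDegree := natDegree_eq_of_degree_eq heq
      rw [hfdeg i (hf0 i hi), hfdeg i' (hf0 i' hi')] at hnd
      have d1 := hdeg' i
      have d2 := hdeg' i'
      obtain ⟨b, j⟩ := i
      obtain ⟨b', j'⟩ := i'
      have key : ∀ r r' s s' : ℕ, r < q → r' < q → r + q * s = r' + q * s' → r = r' ∧ s = s' := by
        intro r r' s s' hr hr' h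
        have e1 : (r + q * s) % q = r := by rw [Nat.add_mul_mod_self_left, Nat.mod_eq_of_lt hr]
        have e2 : (r' + q * s') % q = r' := by rw [Nat.add_mul_mod_self_left, Nat.mod_eq_of_lt hr']
        have e3 : r = r' := by rw [← e1, ← e2, h]
        refine ⟨e3, ?_⟩
        subst e3
        exact Nat.eq_of_mul_eq_mul_left (by omega) (Nat.add_left_cancel h)
      cases b <;> cases b' <;> simp only [if_true, hmk] at hnd d1 d2 ⊢
      · have := key (c (false, j) : K[X]).natDegree (c (false, j') : K[X]).natDegree j j' (by omega)
          (by omega) (by simpa using hnd)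
        exact Prod.ext rfl (Fin.ext this.2)
      · have := key (c (false, j) : K[X]).natDegree ((c (true, j') : K[X]).natDegree + L) j
          (j' + (k - 1) / 2) (by omega) (by omega) (by
          simp at hnd; rw [hnd]; ring)
        omega
      · have := key ((c (true, j) : K[X]).natDegree + L) (c (false, j') : K[X]).natDegree
          (j + (k - 1) / 2) j' (by omega) (by omega) (by simp at hnd; rw [← hnd]; ring)
        omega
      · have := key (c (true, j) : K[X]).natDegree (c (true, j') : K[X]).natDegree j j' (by omega)
          (by omega) (by
          have := hnd
          simp only [Nat.add_assoc, Nat.add_left_comm] at this ⊢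
          omega : (c (true, j) : K[X]).natDegree + q * j = (c (true, j') : K[X]).natDegree + q * j')
        exact Prod.ext rfl (Fin.ext this.2)
  have hR : P ^ M * ∑ i, f i ≠ 0 := mul_ne_zero (pow_ne_zero _ hP0) hS
  have hvan : ∀ x ∈ T.image (algebraMap Fq K), (X - C x) ^ M ∣ P ^ M * ∑ i, f i := by
    intro x hx
    obtain ⟨y, hy, rfl⟩ := Finset.mem_image.1 hx
    set x := algebraMap Fq K y with hxdef
    have hxq : ∀ j : ℕ, x ^ (q * j) = x ^ j := fun j => by
      rw [pow_mul, hxdef, ← map_pow, FiniteField.pow_card]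
    rw [X_sub_C_pow_dvd_iff_taylor]
    intro l hl
    rw [Finset.mul_sum, map_sum, finsetSum_coeff, Fintype.sum_prod_type, Fintype.sum_bool]
    have h0 : ∀ j : Fin J, (taylor x (P ^ M * f (false, j))).coeff l =
        P.eval x ^ (M - l) * ((Φ₀ ⟨l, hl⟩ (c (false, j))).eval x * x ^ (j : ℕ)) := by
      intro j
      have : P ^ M * f (false, j) = (P ^ M * (c (false, j) : K[X])) * X ^ (q * (j : ℕ)) := by
        simp [f]; ring
      rw [this, coeff_taylor_mul_X_pow hcard _ _ _ _ (hl.trans_le hMq), taylor_coeff, hxq]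
      have h := hΦ₀ ⟨l, hl⟩ (c (false, j))
      simp only at h
      rw [h, eval_mul, eval_pow]; ring
    have h1 : ∀ j : Fin J, (taylor x (P ^ M * f (true, j))).coeff l =
        P.eval x ^ (M - l) * ((σ • Φ₁ ⟨l, hl⟩ (c (true, j))).eval x * x ^ (j : ℕ)) := by
      intro j
      have : P ^ M * f (true, j) = (P ^ (M + m) * (c (true, j) : K[X])) * X ^ (q * (j : ℕ)) := by
        simp [f]; ring
      rw [this, coeff_taylor_mul_X_pow hcard _ _ _ _ (hl.trans_le hMq), taylor_coeff, hxq]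
      have h := hΦ₁ ⟨l, hl⟩ (c (true, j))
      simp only at h
      rw [h, eval_mul, eval_pow, eval_smul, smul_eq_mul, ← hT y hy,
        show M + m - l = (M - l) + m by omega, pow_add]
      ring
    simp only [h0, h1]
    rw [← Finset.mul_sum, ← Finset.mul_sum, ← mul_add, ← Finset.sum_add_distrib]
    have := congrArg (eval x) (hQ0 ⟨l, hl⟩)
    rw [hQ, eval_finsetSum, eval_zero] at this
    rw [← mul_zero (P.eval x ^ (M - l)), ← this]
    congr 1
    refine Finset.sum_congr rfl fun j _ => ?_
    rw [eval_mul, eval_add, eval_pow, eval_X]; ring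
  have hfinal := card_mul_le_natDegree hR _ M hvan
  rw [Finset.card_image_of_injective _ (algebraMap Fq K).injective] at hfinal
  refine hfinal.trans ?_
  have hRdeg : (P ^ M * ∑ i, f i).natDegree ≤ M * k + (L + m * k + q * (J - 1)) := by
    refine natDegree_mul_le.trans (Nat.add_le_add (natDegree_pow_le) ?_)
    refine natDegree_sum_le_of_forall_le _ _ fun i _ => ?_
    by_cases hi : (c i : K[X]) = 0
    · simp [f, hi]
    · rw [hfdeg i hi]
      have h1 := hdeg i hi
      have h2 : q * (i.2 : ℕ) ≤ q * (J - 1) := Nat.mul_le_mul_left _ (by have := i.2.2; omega)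
      have h3 : (if i.1 then m else 0) * k ≤ m * k := by split_ifs <;> simp
      omega
  refine hRdeg.trans ?_
  have e1 : J - 1 = t + (k - 1) := by omega
  rw [e1]
  have e2 : q * (t + (k - 1)) + q = q * t + q * k := by
    obtain ⟨b, hb⟩ := Nat.exists_eq_add_of_le hk1
    rw [hb]; simp; ring
  have e3 : m * k ≤ q * k := Nat.mul_le_mul_right _ (by omega)
  omega

end Stepanov

section Moebius

variable {k : Type*} [Field k]

open Classical in
/-- The Möbius function of a polynomial over a field. -/
noncomputable def moebius (f : k[X]) : ℤ :=
  if Squarefree f then (-1) ^ (UniqueFactorizationMonoid.factors f).card else 0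

lemma moebius_one : moebius (1 : k[X]) = 1 := by
  simp [moebius]

lemma moebius_of_not_squarefree {f : k[X]} (hf : ¬ Squarefree f) : moebius f = 0 := by
  simp [moebius, hf]

lemma moebius_of_squarefree {f : k[X]} (hf : Squarefree f) : moebius f = 1 ∨ moebius f = -1 := by
  simp only [moebius, hf, if_true]
  exact neg_one_pow_eq_or ℤ _

lemma moebius_irreducible_mul {P g : k[X]} (hP : Irreducible P) (hg : g ≠ 0) (h : ¬ P ∣ g) :
    moebius (P * g) = -moebius g := by
  have hsq : Squarefree (P * g) ↔ Squarefree g := by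
    rw [squarefree_mul_iff]
    exact ⟨fun h => h.2.2, fun h' => ⟨(hP.coprime_iff_not_dvd.2 h).isRelPrime, hP.squarefree, h'⟩⟩
  by_cases hs : Squarefree g
  · have h1 := Multiset.card_eq_card_of_rel
      (UniqueFactorizationMonoid.factors_mul hP.ne_zero hg)
    obtain ⟨p, -, hp⟩ := UniqueFactorizationMonoid.factors_eq_singleton_of_irreducible hP
    simp only [moebius, hsq, hs, if_true]
    rw [h1, Multiset.card_add, hp]
    simp [pow_add]
  · rw [moebius_of_not_squarefree hs, moebius_of_not_squarefree (mt hsq.1 hs), neg_zero]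

end Moebius

section RootProd

variable {K : Type*} [Field K]

/-- The product of the values of `h` at the roots of `f`. -/
noncomputable def rootProd (f h : K[X]) : K := (f.roots.map fun a => h.eval a).prod

lemma rootProd_mul_left {f₁ f₂ : K[X]} (h₁ : f₁ ≠ 0) (h₂ : f₂ ≠ 0) (h : K[X]) :
    rootProd (f₁ * f₂) h = rootProd f₁ h * rootProd f₂ h := by
  simp [rootProd, roots_mul (mul_ne_zero h₁ h₂)]

lemma rootProd_mul_right (f h₁ h₂ : K[X]) :
    rootProd f (h₁ * h₂) = rootProd f h₁ * rootProd f h₂ := by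
  simp [rootProd, eval_mul]

lemma rootProd_congr {f h₁ h₂ : K[X]} (h : ∀ a, f.IsRoot a → h₁.eval a = h₂.eval a) :
    rootProd f h₁ = rootProd f h₂ := by
  unfold rootProd
  congr 1
  exact Multiset.map_congr rfl fun a ha => h a (isRoot_of_mem_roots ha)

lemma rootProd_ne_zero {f h : K[X]} (H : IsCoprime f h) : rootProd f h ≠ 0 := by
  obtain ⟨u, v, huv⟩ := H
  refine Multiset.prod_ne_zero fun h0 => ?_
  obtain ⟨a, ha, ha'⟩ := Multiset.mem_map.1 h0
  have := congrArg (eval a) huv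
  simp [ha', (isRoot_of_mem_roots ha).eq_zero] at this

lemma rootProd_comm [IsAlgClosed K] (f h : K[X]) :
    f.leadingCoeff ^ h.natDegree * rootProd f h =
      (-1) ^ (f.natDegree * h.natDegree) * (h.leadingCoeff ^ f.natDegree * rootProd h f) := by
  have h1 := resultant_eq_prod_eval f h _ le_rfl (IsAlgClosed.splits f)
  have h2 := resultant_eq_prod_eval h f _ le_rfl (IsAlgClosed.splits h)
  unfold rootProd
  rw [← h1, ← h2, resultant_comm]

/-- The discriminant of a monic polynomial, up to sign. -/
noncomputable def rootDisc (f : K[X]) : K := rootProd f (derivative f)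

lemma rootDisc_mul {f₁ f₂ : K[X]} (h₁ : f₁ ≠ 0) (h₂ : f₂ ≠ 0) :
    rootDisc (f₁ * f₂) =
      rootDisc f₁ * rootDisc f₂ * (rootProd f₁ f₂ * rootProd f₂ f₁) := by
  unfold rootDisc
  rw [rootProd_mul_left h₁ h₂,
    rootProd_congr (f := f₁) (h₂ := derivative f₁ * f₂) (fun a ha => by
      simp [derivative_mul, ha.eq_zero]),
    rootProd_congr (f := f₂) (h₂ := f₁ * derivative f₂) (fun a ha => by
      simp [derivative_mul, ha.eq_zero]),
    rootProd_mul_right, rootProd_mul_right]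
  ring

lemma rootProd_eq_zero {f h : K[X]} (hf : f ≠ 0) {a : K} (ha : f.eval a = 0) (hb : h.eval a = 0) :
    rootProd f h = 0 :=
  Multiset.prod_eq_zero (Multiset.mem_map.2 ⟨a, (mem_roots hf).2 ha, hb⟩)

end RootProd

section Stickelberger

variable {k K : Type*} [Field k] [Fintype k] [Field K] [IsAlgClosed K] [Algebra k K]

lemma rootProd_map_pow {f h : k[X]} (hf : f.Monic) (H : IsCoprime f h) :
    rootProd (f.map (algebraMap k K)) (h.map (algebraMap k K)) ^ (Fintype.card k - 1) = 1 := by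
  have h1 := resultant_eq_prod_eval (f.map (algebraMap k K)) (h.map (algebraMap k K)) _ le_rfl
    (IsAlgClosed.splits _)
  rw [(hf.map _).leadingCoeff, one_pow, one_mul, resultant_map_map, natDegree_map, natDegree_map]
    at h1
  unfold rootProd
  rw [← h1, ← map_pow, FiniteField.pow_card_sub_one_eq_one _ (resultant_ne_zero f h H), map_one]

/-- The sign relating `rootDisc` and `moebius` in degree `N`. -/
noncomputable def stickelbergerSign (k K : Type*) [Fintype k] [Field K] (N : ℕ) : K :=
  ((-1) ^ (N.choose 2)) ^ ((Fintype.card k - 1) / 2) * (-1) ^ N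

omit [Field k] [IsAlgClosed K] [Algebra k K] in
lemma stickelbergerSign_ne_zero (N : ℕ) : stickelbergerSign k K N ≠ 0 := by
  simp [stickelbergerSign]

omit [IsAlgClosed K] in
lemma map_irreducible_eq_prod {f : k[X]} (hf : f.Monic) (hi : Irreducible f) {θ : K}
    (hθ : aeval θ f = 0) :
    (Function.Injective fun i : Fin f.natDegree => θ ^ Fintype.card k ^ (i : ℕ)) ∧
    θ ^ Fintype.card k ^ f.natDegree = θ ∧
    f.map (algebraMap k K) = ∏ i : Fin f.natDegree, (X - C (θ ^ Fintype.card k ^ (i : ℕ))) := by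
  classical
  obtain ⟨p, hp, n, hpp, hcard⟩ := FiniteField.card' k
  have : Fact p.Prime := ⟨hpp⟩
  have : CharP K p := charP_of_injective_algebraMap (algebraMap k K).injective p
  set q := Fintype.card k with hq
  have hroot : ∀ i : ℕ, θ ^ q ^ i = θ → f.natDegree ∣ i := by
    intro i h
    apply hi.natDegree_dvd_of_dvd_X_pow_card_pow_sub_X
    rw [← hi.dvd_iff_aeval_eq_zero hθ, Nat.card_eq_fintype_card, ← hq]
    simp [h]
  have hinj : ∀ i j : ℕ, i < j → j < f.natDegree → θ ^ q ^ i ≠ θ ^ q ^ j := by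
    intro i j hij hj h
    obtain ⟨d, rfl⟩ := Nat.exists_eq_add_of_lt hij
    have h1 : θ = θ ^ q ^ (d + 1) := by
      have hinj := iterateFrobenius_inj K p (n * i)
      apply hinj
      simp only [iterateFrobenius_def]
      rw [pow_mul p, ← hcard, h, ← pow_mul, ← pow_add]
      congr 2; omega
    have := Nat.le_of_dvd (by omega) (hroot _ h1.symm)
    omega
  have hinj' : Function.Injective fun i : Fin f.natDegree => θ ^ q ^ (i : ℕ) := by
    intro i j h
    rcases lt_trichotomy i j with hij | hij | hij
    · exact absurd h (hinj _ _ hij j.2)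
    · exact hij
    · exact absurd h.symm (hinj _ _ hij i.2)
  have hper : θ ^ q ^ f.natDegree = θ := by
    have h1 := hi.natDegree_dvd_iff_dvd_X_pow_card_pow_sub_X.1 (dvd_refl f.natDegree)
    rw [← hi.dvd_iff_aeval_eq_zero hθ, Nat.card_eq_fintype_card, ← hq] at h1
    simpa [sub_eq_zero] using h1
  refine ⟨hinj', hper, ?_⟩
  have hev : ∀ i : ℕ, aeval (θ ^ q ^ i) f = 0 := by
    intro i
    induction i with
    | zero => simpa using hθ
    | succ i ih =>
      rw [pow_succ, pow_mul]
      change aeval (FiniteField.frobeniusAlgHom k K (θ ^ q ^ i)) f = 0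
      rw [aeval_algHom_apply, ih, map_zero]
  have hdvd : ∏ i : Fin f.natDegree, (X - C (θ ^ q ^ (i : ℕ))) ∣ f.map (algebraMap k K) := by
    apply Finset.prod_dvd_of_coprime
    · intro i _ j _ hij
      exact pairwise_coprime_X_sub_C hinj' hij
    · intro i _
      rw [dvd_iff_isRoot, IsRoot.def, eval_map_algebraMap]
      exact hev i
  refine (eq_of_monic_of_dvd_of_natDegree_le (monic_prod_of_monic _ _ fun i _ => monic_X_sub_C _)
    (hf.map _) hdvd ?_)
  rw [natDegree_prod_of_monic _ _ fun i _ => monic_X_sub_C _]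
  simp only [natDegree_X_sub_C, Finset.sum_const, Finset.card_univ, Fintype.card_fin, smul_eq_mul,
    mul_one, natDegree_map, le_refl]

lemma rootDisc_irreducible_pow (hk : Odd (Fintype.card k)) {f : k[X]} (hf : f.Monic)
    (hi : Irreducible f) :
    rootDisc (f.map (algebraMap k K)) ^ ((Fintype.card k - 1) / 2) =
      ((-1) ^ (f.natDegree.choose 2)) ^ ((Fintype.card k - 1) / 2) * (-1) ^ (f.natDegree - 1) := by
  classical
  obtain ⟨θ, hθ⟩ := IsAlgClosed.exists_aeval_eq_zero K f (degree_pos_of_irreducible hi).ne'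
  obtain ⟨hinj, hper, hprod⟩ := map_irreducible_eq_prod hf hi hθ
  have hq2 : 2 * ((Fintype.card k - 1) / 2) + 1 = Fintype.card k := by
    obtain ⟨a, ha⟩ := hk; omega
  set q := Fintype.card k with hq
  set N := f.natDegree with hN
  have hN1 : 0 < N := hi.natDegree_pos
  set v : Fin N → K := fun i => θ ^ q ^ (i : ℕ) with hv
  set δ := (Matrix.vandermonde v).det with hδ
  have hδ0 : δ ≠ 0 := Matrix.det_vandermonde_ne_zero_iff.2 hinj
  have hD : rootDisc (f.map (algebraMap k K)) = (-1) ^ (N.choose 2) * δ ^ 2 := by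
    rw [rootDisc, rootProd, hprod]
    rw [show (∏ i : Fin N, (X - C (θ ^ q ^ (i : ℕ)))) = ∏ i : Fin N, (X - C (v i)) from rfl]
    have hroots : (∏ i : Fin N, (X - C (v i))).roots = Finset.univ.val.map v := by
      rw [← roots_multiset_prod_X_sub_C (Finset.univ.val.map v), Multiset.map_map]; rfl
    rw [hroots, Multiset.map_map]
    change ∏ i : Fin N, eval (v i) (derivative (∏ i : Fin N, (X - C (v i)))) = _
    have : ∀ i : Fin N, eval (v i) (derivative (∏ i : Fin N, (X - C (v i)))) =
        ∏ j ∈ {i}ᶜ, (v i - v j) := by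
      intro i
      rw [derivative_prod_finset, eval_finsetSum, Finset.sum_eq_single i]
      · rw [Finset.compl_singleton]
        simp [eval_prod]
      · intro j _ hj
        rw [eval_mul, eval_prod, Finset.prod_eq_zero (i := i)] <;> simp [hj.symm]
      · simp
    simp_rw [this]
    rw [← Finset.prod_prod_Ioi_mul_eq_prod_prod_off_diag (fun j i => v i - v j), hδ,
      Matrix.det_vandermonde]
    have h2 : ∀ i : Fin N, ∏ j ∈ Finset.Ioi i, (v i - v j) * (v j - v i) =
        (-1) ^ (N - 1 - (i : ℕ)) * (∏ j ∈ Finset.Ioi i, (v j - v i)) ^ 2 := by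
      intro i
      rw [← Fin.card_Ioi, ← Finset.prod_const, ← Finset.prod_pow, ← Finset.prod_mul_distrib]
      exact Finset.prod_congr rfl fun j _ => by ring
    rw [Finset.prod_congr rfl fun i _ => h2 i, Finset.prod_mul_distrib, Finset.prod_pow,
      Finset.prod_pow_eq_pow_sum, Fin.sum_univ_eq_sum_range (fun i => N - 1 - i) N,
      Finset.sum_range_reflect (fun i => i) N, Finset.sum_range_id, Nat.choose_two_right]
  have hfrob : δ ^ q = (-1) ^ (N - 1) * δ := by
    have h1 : (FiniteField.frobeniusAlgHom k K).mapMatrix (Matrix.vandermonde v) =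
        (Matrix.vandermonde v).submatrix (finRotate N) id := by
      ext i j
      have : v (finRotate N i) = v i ^ q := by
        simp only [hv]
        obtain ⟨N', hN'⟩ := Nat.exists_eq_succ_of_ne_zero hN1.ne'
        clear_value N
        subst hN'
        rw [coe_finRotate, ← pow_mul, ← pow_succ]
        split_ifs with h
        · rw [h, Fin.val_last, hper]; simp
        · rfl
      change (v i ^ (j : ℕ)) ^ q = v (finRotate N i) ^ (j : ℕ)
      rw [this, pow_right_comm]
    have h2 : FiniteField.frobeniusAlgHom k K δ = δ ^ q := rfl
    rw [← h2, hδ, AlgHom.map_det, h1, Matrix.det_permute, sign_finRotate]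
    simp
  rw [hD, mul_pow, ← pow_mul δ]
  congr 1
  apply mul_right_cancel₀ hδ0
  rw [← pow_succ, hq2, hfrob]

/-- **Stickelberger's theorem** on the parity of the number of irreducible factors. -/
theorem rootDisc_map_pow (hk : Odd (Fintype.card k)) {f : k[X]} (hf : f.Monic) :
    rootDisc (f.map (algebraMap k K)) ^ ((Fintype.card k - 1) / 2) =
      stickelbergerSign k K f.natDegree * moebius f := by
  induction hN : f.natDegree using Nat.strong_induction_on generalizing f with
  | _ N ih =>
  by_cases hf1 : f = 1
  · subst hf1
    simp at hN
    subst hN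
    simp [rootDisc, rootProd, moebius_one, stickelbergerSign]
  obtain ⟨P, hPm, hPi, g, rfl⟩ := exists_monic_irreducible_factor f
    (fun h => hf1 (hf.eq_one_of_isUnit h))
  have hg : g.Monic := hPm.of_mul_monic_left hf
  have hq2 : 2 * ((Fintype.card k - 1) / 2) = Fintype.card k - 1 := by
    obtain ⟨a, ha⟩ := hk; omega
  have hq3 : 3 ≤ Fintype.card k := by
    have := Fintype.one_lt_card (α := k)
    obtain ⟨a, ha⟩ := hk; omega
  have hPg0 : P.map (algebraMap k K) ≠ 0 := (hPm.map _).ne_zero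
  have hg0 : g.map (algebraMap k K) ≠ 0 := (hg.map _).ne_zero
  rw [Polynomial.map_mul, rootDisc_mul hPg0 hg0]
  by_cases hdvd : P ∣ g
  · have hns : ¬ Squarefree (P * g) := by
      obtain ⟨u, rfl⟩ := hdvd
      intro hs
      exact hPi.not_isUnit (hs P ⟨u, by ring⟩)
    obtain ⟨θ, hθ⟩ := IsAlgClosed.exists_aeval_eq_zero K P (degree_pos_of_irreducible hPi).ne'
    rw [moebius_of_not_squarefree hns, rootProd_eq_zero hPg0 (a := θ)]
    · simp; omega
    · rwa [eval_map_algebraMap]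
    · obtain ⟨u, rfl⟩ := hdvd
      simp [eval_map_algebraMap, hθ]
  · have hcop : IsCoprime P g := hPi.coprime_iff_not_dvd.2 hdvd
    have hdeg : (P * g).natDegree = P.natDegree + g.natDegree := hPm.natDegree_mul hg
    have hPpos := hPi.natDegree_pos
    have h1 := rootProd_comm (P.map (algebraMap k K)) (g.map (algebraMap k K))
    rw [(hPm.map _).leadingCoeff, (hg.map _).leadingCoeff, natDegree_map, natDegree_map, one_pow,
      one_pow, one_mul, one_mul] at h1
    have h2 : rootProd (P.map (algebraMap k K)) (g.map (algebraMap k K)) *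
        rootProd (g.map (algebraMap k K)) (P.map (algebraMap k K)) =
        (-1) ^ (P.natDegree * g.natDegree) *
          rootProd (g.map (algebraMap k K)) (P.map (algebraMap k K)) ^ 2 := by
      rw [h1]; ring
    rw [h2, mul_pow, mul_pow, mul_pow, ← pow_mul (rootProd _ _), hq2,
      rootProd_map_pow hg hcop.symm, rootDisc_irreducible_pow hk hPm hPi,
      ih g.natDegree (by omega) hg rfl, moebius_irreducible_mul hPi hg.ne_zero hdvd]
    have h3 : N.choose 2 = P.natDegree.choose 2 + g.natDegree.choose 2 +
        P.natDegree * g.natDegree := by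
      rw [← hN, hdeg, Nat.add_choose_eq, Finset.Nat.sum_antidiagonal_eq_sum_range_succ_mk]
      simp [Finset.sum_range_succ]; ring
    obtain ⟨e, he⟩ := Nat.exists_eq_succ_of_ne_zero hPpos.ne'
    unfold stickelbergerSign
    rw [h3, ← hN, hdeg, he]
    push_cast
    simp only [Nat.succ_eq_add_one, pow_add, mul_pow]
    ring

end Stickelberger

section Line

variable {K : Type*} [Field K]

/-- The product of `a + X b` over the roots of `f`, as a polynomial. -/
noncomputable def linProd (f a b : K[X]) : K[X] :=
  (f.roots.map fun w => C (a.eval w) + C (b.eval w) * X).prod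

lemma eval_linProd (f a b : K[X]) (s : K) :
    (linProd f a b).eval s = rootProd f (a + C s * b) := by
  rw [linProd, rootProd, eval_multiset_prod, Multiset.map_map]
  congr 1
  refine Multiset.map_congr rfl fun w _ => ?_
  simp only [Function.comp_apply, eval_add, eval_mul, eval_C, eval_X]
  ring

lemma eval_ne_zero_of_isCoprime {f b : K[X]} (h : IsCoprime f b) {w : K} (hw : f.eval w = 0) :
    b.eval w ≠ 0 := by
  obtain ⟨u, v, huv⟩ := h
  intro hb
  have := congrArg (eval w) huv
  simp [hw, hb] at this

lemma linProd_ne_zero {f a b : K[X]} (h : IsCoprime f b) : linProd f a b ≠ 0 := by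
  refine Multiset.prod_ne_zero fun h0 => ?_
  obtain ⟨w, hw, hw'⟩ := Multiset.mem_map.1 h0
  have := congrArg (fun p => coeff p 1) hw'
  simp [coeff_C, eval_ne_zero_of_isCoprime h (isRoot_of_mem_roots hw)] at this

lemma natDegree_linProd [IsAlgClosed K] {f a b : K[X]} (h : IsCoprime f b) :
    (linProd f a b).natDegree = f.natDegree := by
  rw [linProd, natDegree_multiset_prod, Multiset.map_map,
    ← splits_iff_card_roots.1 (IsAlgClosed.splits f)]
  · rw [Multiset.map_congr rfl (g := fun _ => 1)]
    · simp
    · intro w hw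
      have hb := eval_ne_zero_of_isCoprime h (isRoot_of_mem_roots hw)
      rw [Function.comp_apply, add_comm, natDegree_linear hb]
  · intro h0
    obtain ⟨w, hw, hw'⟩ := Multiset.mem_map.1 h0
    have := congrArg (fun p => coeff p 1) hw'
    simp [coeff_C, eval_ne_zero_of_isCoprime h (isRoot_of_mem_roots hw)] at this

/-- The leading term of a Wronskian. -/
lemma natDegree_wronskian {E g : K[X]} (hg : g.Monic) {δ : ℕ} (hδ : (δ : K) ≠ 0) (hE : E ≠ 0)
    (hdeg : E.natDegree + δ = g.natDegree) :
    E * derivative g - derivative E * g ≠ 0 ∧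
    (E * derivative g - derivative E * g).natDegree + 1 = E.natDegree + g.natDegree := by
  have hδ0 : δ ≠ 0 := by rintro rfl; simp at hδ
  obtain ⟨d, hd⟩ : ∃ d, g.natDegree = d + 1 := ⟨g.natDegree - 1, by omega⟩
  have hc : (E * derivative g - derivative E * g).coeff (E.natDegree + d) =
      E.leadingCoeff * δ := by
    have h1 : (E * derivative g).coeff (E.natDegree + d) = E.leadingCoeff * (d + 1) := by
      rw [coeff_mul_add_eq_of_natDegree_le le_rfl ((natDegree_derivative_le g).trans (by omega)),
        coeff_derivative, ← hd, hg.coeff_natDegree, one_mul, leadingCoeff]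
    have h2 : (derivative E * g).coeff (E.natDegree + d) = E.leadingCoeff * E.natDegree := by
      rcases Nat.eq_zero_or_pos E.natDegree with h0 | h0
      · rw [natDegree_eq_zero.1 h0 |>.choose_spec.symm]; simp
      · obtain ⟨e, he⟩ := Nat.exists_eq_succ_of_ne_zero h0.ne'
        rw [show E.natDegree + d = e + g.natDegree by omega,
          coeff_mul_add_eq_of_natDegree_le ((natDegree_derivative_le E).trans (by omega)) le_rfl,
          coeff_derivative, ← Nat.succ_eq_add_one, ← he, hg.coeff_natDegree, mul_one]
        rw [coeff_natDegree, he]; push_cast; ring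
    rw [coeff_sub, h1, h2, ← mul_sub]
    congr 1
    have : (d + 1 : K) = ((E.natDegree + δ : ℕ) : K) := by rw [hdeg, hd]; push_cast; ring
    rw [this]; push_cast; ring
  have hc0 : (E * derivative g - derivative E * g).coeff (E.natDegree + d) ≠ 0 := by
    rw [hc]; exact mul_ne_zero (leadingCoeff_ne_zero.2 hE) hδ
  refine ⟨fun h => hc0 (by rw [h, coeff_zero]), ?_⟩
  have h1 := le_natDegree_of_ne_zero hc0
  have h2 : (E * derivative g - derivative E * g).natDegree ≤ E.natDegree + d := by
    refine (natDegree_sub_le _ _).trans (max_le ?_ ?_)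
    · exact natDegree_mul_le.trans (by have := natDegree_derivative_le g; omega)
    · rcases Nat.eq_zero_or_pos E.natDegree with h0 | h0
      · obtain ⟨c, hc⟩ := natDegree_eq_zero.1 h0
        rw [← hc]; simp
      · exact natDegree_mul_le.trans (by have := natDegree_derivative_le E; omega)
  omega

lemma rootProd_monic_comm [IsAlgClosed K] {h : K[X]} (hh : h.Monic) (f : K[X]) :
    rootProd h f = (-1) ^ (h.natDegree * f.natDegree) * f.leadingCoeff ^ h.natDegree *
      rootProd f h := by
  have := rootProd_comm h f
  rwa [hh.leadingCoeff, one_pow, one_mul, ← mul_assoc] at this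

/-- The discriminant along a line `h + s E`. -/
lemma rootDisc_add_C_mul [IsAlgClosed K] {h E : K[X]} (hh : h.Monic) (hE : E ≠ 0) {δ : ℕ}
    (hδ : (δ : K) ≠ 0) (hdeg : E.natDegree + δ = h.natDegree) (hcop : IsCoprime E h) :
    ∃ c : K, c ≠ 0 ∧ ∀ s : K, rootDisc (h + C s * E) =
      c * (linProd (E * derivative h - derivative E * h) h E).eval s := by
  obtain ⟨hW, -⟩ := natDegree_wronskian hh hδ hE hdeg
  set W := E * derivative h - derivative E * h with hWdef
  have hδ0 : 0 < δ := Nat.pos_of_ne_zero (by rintro rfl; simp at hδ)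
  have hlt : ∀ s : K, (C s * E).natDegree < h.natDegree := fun s =>
    (natDegree_C_mul_le s E).trans_lt (by omega)
  have hmon : ∀ s : K, (h + C s * E).Monic := fun s =>
    hh.add_of_left (degree_lt_degree (hlt s))
  have hnd : ∀ s : K, (h + C s * E).natDegree = h.natDegree := fun s =>
    natDegree_add_eq_left_of_natDegree_lt (hlt s)
  set c₁ : K := (-1) ^ (h.natDegree * E.natDegree) * E.leadingCoeff ^ h.natDegree * rootProd E h
  set c₂ : K := (-1) ^ (h.natDegree * W.natDegree) * W.leadingCoeff ^ h.natDegree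
  have hc₁ : c₁ ≠ 0 := mul_ne_zero (mul_ne_zero (by simp) (pow_ne_zero _ (by simpa using hE)))
    (rootProd_ne_zero hcop)
  have hc₂ : c₂ ≠ 0 := mul_ne_zero (by simp) (pow_ne_zero _ (by simpa using hW))
  refine ⟨c₁⁻¹ * c₂, mul_ne_zero (inv_ne_zero hc₁) hc₂, fun s => ?_⟩
  have e1 : rootProd (h + C s * E) E = c₁ := by
    rw [rootProd_monic_comm (hmon s), hnd,
      rootProd_congr (f := E) (h₁ := h + C s * E) (h₂ := h) fun a ha => by simp [ha.eq_zero]]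
  have e2 : rootProd (h + C s * E) W = c₂ * (linProd W h E).eval s := by
    rw [rootProd_monic_comm (hmon s), hnd, eval_linProd]
  have e3 : rootProd (h + C s * E) E * rootDisc (h + C s * E) = rootProd (h + C s * E) W := by
    rw [rootDisc, ← rootProd_mul_right]
    refine rootProd_congr fun a ha => ?_
    have ha' : h.eval a = - (s * E.eval a) := by
      have := ha.eq_zero
      simp only [eval_add, eval_mul, eval_C] at this
      linear_combination this
    simp only [hWdef, derivative_add, derivative_mul, derivative_C, eval_mul, eval_add, eval_sub,
      eval_C, zero_mul, zero_add, ha']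
    ring
  rw [e1, e2] at e3
  rw [mul_assoc, ← e3, inv_mul_cancel_left₀ hc₁]

end Line

section MoebiusLine

variable {k : Type*} (K : Type*) [Field k] [Fintype k] [Field K] [IsAlgClosed K] [Algebra k K]

/-- Along a line `g + s E` the Möbius function is, up to a constant, the quadratic character of a
polynomial in `s`. -/
theorem moebius_add_C_mul (hk : Odd (Fintype.card k)) {g E : k[X]} (hg : g.Monic)
    (hE : Squarefree E) {δ : ℕ} (hδ : (δ : k) ≠ 0) (hdeg : E.natDegree + δ = g.natDegree) :
    ∃ (Δ : K[X]) (κ : K), κ ≠ 0 ∧ Δ ≠ 0 ∧ Δ.natDegree + δ + 1 = 2 * g.natDegree ∧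
      ∀ s : k, (moebius (g + C s * E) : K) =
        κ * (Δ.eval (algebraMap k K s)) ^ ((Fintype.card k - 1) / 2) := by
  have hE0 : E ≠ 0 := hE.ne_zero
  have hδ0 : 0 < δ := Nat.pos_of_ne_zero (by rintro rfl; simp at hδ)
  obtain ⟨G, g₁, E₁, hG, rfl, rfl, hcop⟩ : ∃ G g₁ E₁ : k[X], G.Monic ∧ g = G * g₁ ∧
      E = G * E₁ ∧ IsCoprime E₁ g₁ := by
    classical
    let _ := UniqueFactorizationMonoid.toGCDMonoid k[X]
    have h0 := gcd_ne_zero_of_right (a := E) hg.ne_zero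
    have h1 := EuclideanDomain.mul_div_cancel' h0 (gcd_dvd_left E g)
    have h2 := EuclideanDomain.mul_div_cancel' h0 (gcd_dvd_right E g)
    have h3 : IsCoprime (E / gcd E g) (g / gcd E g) := isCoprime_div_gcd_div_gcd hg.ne_zero
    set G := gcd E g
    have hu : C G.leadingCoeff⁻¹ * C G.leadingCoeff = 1 := by
      rw [← C_mul, inv_mul_cancel₀ (leadingCoeff_ne_zero.2 h0), C_1]
    have hu' : IsUnit (C G.leadingCoeff) := .of_mul_eq_one_right _ hu
    refine ⟨G * C G.leadingCoeff⁻¹, C G.leadingCoeff * (g / G), C G.leadingCoeff * (E / G),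
      monic_mul_leadingCoeff_inv h0, ?_, ?_,
      (isCoprime_mul_unit_left hu' _ _).2 h3⟩
    · linear_combination (-1 : k[X]) * h2 - G * (g / G) * hu
    · linear_combination (-1 : k[X]) * h1 - G * (E / G) * hu
  have hg₁ : g₁.Monic := hG.of_mul_monic_left hg
  have hE₁0 : E₁ ≠ 0 := right_ne_zero_of_mul hE0
  rw [hG.natDegree_mul hg₁, hG.natDegree_mul' hE₁0] at hdeg
  have hdeg₁ : E₁.natDegree + δ = g₁.natDegree := by omega
  have hGsq : Squarefree G := hE.of_mul_left
  have hE₁sq : Squarefree E₁ := hE.of_mul_right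
  have hGE₁ : IsCoprime G E₁ := (squarefree_mul_iff.1 hE).1.isCoprime
  obtain ⟨hW, hWdeg⟩ := natDegree_wronskian hg₁ hδ hE₁0 hdeg₁
  have hWcop : IsCoprime (E₁ * derivative g₁ - derivative E₁ * g₁) E₁ := by
    have h1 : IsCoprime E₁ (-derivative E₁ * g₁) :=
      (PerfectField.separable_iff_squarefree.2 hE₁sq).neg_right.mul_right hcop
    have := h1.add_mul_left_right (derivative g₁)
    rw [show -derivative E₁ * g₁ + E₁ * derivative g₁ =
      E₁ * derivative g₁ - derivative E₁ * g₁ by ring] at this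
    exact this.symm
  set W := E₁ * derivative g₁ - derivative E₁ * g₁ with hWdef
  set φ := algebraMap k K with hφ
  have hWmap : W.map φ = E₁.map φ * derivative (g₁.map φ) - derivative (E₁.map φ) * g₁.map φ := by
    simp [hWdef, Polynomial.map_sub, Polynomial.map_mul, derivative_map]
  obtain ⟨c, hc, hdisc⟩ := rootDisc_add_C_mul (hg₁.map φ) ((Polynomial.map_ne_zero_iff
    φ.injective).2 hE₁0) (δ := δ) (by rw [← map_natCast φ]; exact (map_ne_zero φ).2 hδ)
    (by simpa using hdeg₁) (hcop.map (mapRingHom φ))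
  rw [← hWmap] at hdisc
  have hm : ∀ f h : k[X], IsCoprime f h → IsCoprime (f.map φ) (h.map φ) :=
    fun f h H => H.map (mapRingHom φ)
  set D := rootDisc (G.map φ)
  have hD : D ≠ 0 := rootProd_ne_zero (by
    rw [derivative_map]
    exact hm _ _ (PerfectField.separable_iff_squarefree.2 hGsq))
  set Λ := linProd (W.map φ) (g₁.map φ) (E₁.map φ)
  set Γ := linProd (G.map φ) (g₁.map φ) (E₁.map φ)
  set m := (Fintype.card k - 1) / 2
  set σ := stickelbergerSign k K (G * g₁).natDegree
  set e := g₁.natDegree * G.natDegree with he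
  refine ⟨Λ * Γ ^ 2, σ⁻¹ * (D * c * (-1) ^ e) ^ m, mul_ne_zero (inv_ne_zero
    (stickelbergerSign_ne_zero _)) (pow_ne_zero _ (mul_ne_zero (mul_ne_zero hD hc) (by simp))),
    mul_ne_zero (linProd_ne_zero (hm _ _ hWcop)) (pow_ne_zero _ (linProd_ne_zero (hm _ _ hGE₁))),
    ?_, fun s => ?_⟩
  · rw [natDegree_mul (linProd_ne_zero (hm _ _ hWcop))
      (pow_ne_zero _ (linProd_ne_zero (hm _ _ hGE₁))), natDegree_pow,
      natDegree_linProd (hm _ _ hWcop), natDegree_linProd (hm _ _ hGE₁), natDegree_map,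
      natDegree_map, hG.natDegree_mul hg₁]
    omega
  · set h := g₁ + C s * E₁ with hh
    have hlt : (C s * E₁).natDegree < g₁.natDegree :=
      (natDegree_C_mul_le s E₁).trans_lt (by omega)
    have hmon : h.Monic := hg₁.add_of_left (degree_lt_degree hlt)
    have hnd : h.natDegree = g₁.natDegree := natDegree_add_eq_left_of_natDegree_lt hlt
    have hhm : h.map φ = g₁.map φ + C (φ s) * E₁.map φ := by simp [hh]
    have hprod : G * g₁ + C s * (G * E₁) = G * h := by rw [hh]; ring
    have hst := rootDisc_map_pow (K := K) hk (hG.mul hmon)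
    rw [hG.natDegree_mul hmon, hnd, ← hG.natDegree_mul hg₁] at hst
    rw [hprod, eq_inv_mul_iff_mul_eq₀ (stickelbergerSign_ne_zero _) |>.2 hst.symm, mul_assoc,
      ← mul_pow]
    congr 2
    rw [Polynomial.map_mul, rootDisc_mul (hG.map φ).ne_zero (hmon.map φ).ne_zero,
      rootProd_monic_comm (hmon.map φ), (hG.map φ).leadingCoeff, natDegree_map, natDegree_map, hnd,
      hhm, hdisc, eval_mul, eval_pow, eval_linProd (G.map φ)]
    ring

end MoebiusLine

section CharacterSum

variable {k K : Type*} [Field k] [Fintype k] [Field K] [Algebra k K]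

omit [Fintype k] in
lemma card_eval_algebraMap_eq_zero_le {Δ : K[X]} (hΔ : Δ ≠ 0) (T : Finset k)
    (hT : ∀ s ∈ T, Δ.eval (algebraMap k K s) = 0) : T.card ≤ Δ.natDegree := by
  classical
  have := card_mul_le_natDegree hΔ (T.image (algebraMap k K)) 1 (fun x hx => by
    obtain ⟨s, hs, rfl⟩ := Finset.mem_image.1 hx
    rw [pow_one, dvd_iff_isRoot]
    exact hT s hs)
  rwa [Finset.card_image_of_injective _ (algebraMap k K).injective, one_mul] at this

lemma exists_stepanov_parameter {q : ℕ} (hq : 32 ≤ q) :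
    ∃ t : ℕ, 1 ≤ t ∧ 32 * t ^ 2 ≤ q ∧ (q : ℝ) ≤ 12 * t * √q := by
  set x : ℝ := √(q / 32) with hx
  have hq' : (32 : ℝ) ≤ q := by exact_mod_cast hq
  have hx1 : 1 ≤ x := Real.one_le_sqrt.2 (by rw [le_div_iff₀ (by norm_num)]; linarith)
  have hx2 : x ^ 2 = q / 32 := Real.sq_sqrt (by positivity)
  have ht1 : 1 ≤ ⌊x⌋₊ := Nat.le_floor (by simpa using hx1)
  have hle : (⌊x⌋₊ : ℝ) ≤ x := Nat.floor_le (by positivity)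
  have hlt : x < ⌊x⌋₊ + 1 := Nat.lt_floor_add_one x
  have ht1' : (1 : ℝ) ≤ ⌊x⌋₊ := by exact_mod_cast ht1
  refine ⟨⌊x⌋₊, ht1, ?_, ?_⟩
  · have : (32 : ℝ) * (⌊x⌋₊ : ℝ) ^ 2 ≤ q := by
      have : (⌊x⌋₊ : ℝ) ^ 2 ≤ x ^ 2 := pow_le_pow_left₀ (by positivity) hle 2
      rw [hx2] at this; linarith
    exact_mod_cast this
  · have hs : √(q : ℝ) ^ 2 = q := Real.sq_sqrt (by positivity)
    have hs0 : 0 ≤ √(q : ℝ) := Real.sqrt_nonneg _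
    have h1 : √(q : ℝ) ≤ 6 * x := by
      apply Real.sqrt_le_iff.2 ⟨by positivity, ?_⟩
      rw [mul_pow, hx2]; linarith
    nlinarith

/-- A sum of values of a quadratic character at a polynomial of odd degree is `O(√q)`. -/
lemma abs_sum_le_of_eq_eval_pow (hk : Odd (Fintype.card k)) (h32 : 32 ≤ Fintype.card k)
    {Δ : K[X]} {κ : K} (hκ : κ ≠ 0) (hΔ : Odd Δ.natDegree)
    (hdeg : 2 * Δ.natDegree ≤ Fintype.card k) (v : k → ℤ)
    (hv : ∀ s, (v s : K) = κ * (Δ.eval (algebraMap k K s)) ^ ((Fintype.card k - 1) / 2))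
    (hv1 : ∀ s, v s = 0 ∨ v s = 1 ∨ v s = -1) :
    |∑ s, (v s : ℝ)| ≤ 27 * Δ.natDegree * √(Fintype.card k) := by
  classical
  obtain ⟨t, ht, htq, hqt⟩ := exists_stepanov_parameter h32
  have hΔ0 : Δ ≠ 0 := by rintro rfl; simp at hΔ
  have hT : ∀ c : ℤ, 2 * t * (Finset.univ.filter fun s => v s = c).card ≤
      Fintype.card k * t + 2 * t * Δ.natDegree + 2 * (Fintype.card k * Δ.natDegree) := fun c =>
    stepanov hk hΔ hdeg ht htq (κ⁻¹ * c) _ fun s hs => by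
      rw [← (Finset.mem_filter.1 hs).2, hv, inv_mul_cancel_left₀ hκ]
  have hm0 : (Fintype.card k - 1) / 2 ≠ 0 := by omega
  have h0 : (Finset.univ.filter fun s => v s = 0).card ≤ Δ.natDegree :=
    card_eval_algebraMap_eq_zero_le hΔ0 _ fun s hs => by
      have h := hv s
      rw [(Finset.mem_filter.1 hs).2, Int.cast_zero, eq_comm, mul_eq_zero] at h
      exact pow_eq_zero_iff hm0 |>.1 (h.resolve_left hκ)
  set A0 := (Finset.univ.filter fun s => v s = 0).card
  set A1 := (Finset.univ.filter fun s => v s = 1).card with hA1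
  set A2 := (Finset.univ.filter fun s => v s = -1).card with hA2
  have hsum : ∑ s, (v s : ℝ) = A1 - A2 := by
    rw [hA1, hA2, Finset.card_filter, Finset.card_filter]
    push_cast
    rw [← Finset.sum_sub_distrib]
    refine Finset.sum_congr rfl fun s _ => ?_
    rcases hv1 s with h | h | h <;> simp [h]
  have hcard : (A0 : ℝ) + A1 + A2 = Fintype.card k := by
    simp only [A0, A1, A2, Finset.card_filter]
    push_cast
    rw [← Finset.sum_add_distrib, ← Finset.sum_add_distrib, ← Finset.card_univ,
      Finset.card_eq_sum_ones]
    push_cast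
    refine Finset.sum_congr rfl fun s _ => ?_
    rcases hv1 s with h | h | h <;> simp [h]
  have h1 : (2 : ℝ) * t * A1 ≤ Fintype.card k * t + 2 * t * Δ.natDegree +
    2 * (Fintype.card k * Δ.natDegree) := by exact_mod_cast hT 1
  have h2 : (2 : ℝ) * t * A2 ≤ Fintype.card k * t + 2 * t * Δ.natDegree +
    2 * (Fintype.card k * Δ.natDegree) := by exact_mod_cast hT (-1)
  have h0' : (A0 : ℝ) ≤ Δ.natDegree := by exact_mod_cast h0
  have ht' : (1 : ℝ) ≤ t := by exact_mod_cast ht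
  set q : ℝ := (Fintype.card k : ℝ)
  have hq1 : 1 ≤ √q := Real.one_le_sqrt.2 (by simp only [q]; exact_mod_cast (by omega))
  set d : ℝ := (Δ.natDegree : ℝ)
  have hd : 0 ≤ d := Nat.cast_nonneg _
  have e0 : t * (A0 : ℝ) ≤ t * d := by gcongr
  have e1 : q * d ≤ 12 * t * √q * d := by gcongr
  have e2 : t * d ≤ t * d * √q := le_mul_of_one_le_right (by positivity) hq1
  have key : t * |∑ s, (v s : ℝ)| ≤ t * (27 * d * √q) := by
    rw [hsum, ← abs_of_pos (show (0 : ℝ) < t by linarith), ← abs_mul,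
      abs_of_pos (show (0 : ℝ) < t by linarith), abs_le]
    have e3 : (t : ℝ) * A0 + t * A1 + t * A2 = q * t := by rw [← hcard]; ring
    constructor <;> nlinarith
  exact le_of_mul_le_mul_left key (by linarith)

end CharacterSum

section MoebiusSum

variable {k : Type*} [Field k] [Fintype k]

omit [Fintype k] in
lemma moebius_eq (f : k[X]) : moebius f = 0 ∨ moebius f = 1 ∨ moebius f = -1 := by
  by_cases h : Squarefree f
  · exact Or.inr (moebius_of_squarefree h)
  · exact Or.inl (moebius_of_not_squarefree h)

lemma two_ne_zero_of_odd_card (hk : Odd (Fintype.card k)) : ((2 : ℕ) : k) ≠ 0 := by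
  intro h
  have h1 := (FiniteField.cast_card_eq_zero k)
  obtain ⟨a, ha⟩ := hk
  rw [ha] at h1
  push_cast at h h1
  simp [h] at h1

/-- The Möbius function has cancellation on lines in a direction of codegree two. -/
theorem abs_sum_moebius_le (hk : Odd (Fintype.card k)) (h32 : 32 ≤ Fintype.card k)
    {g E : k[X]} (hg : g.Monic) (hE : Squarefree E) (hdeg : E.natDegree + 2 = g.natDegree)
    (hgk : 4 * g.natDegree ≤ Fintype.card k) :
    |∑ s : k, (moebius (g + C s * E) : ℝ)| ≤ 54 * g.natDegree * √(Fintype.card k) := by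
  obtain ⟨Δ, κ, hκ, -, hΔ, hv⟩ := moebius_add_C_mul (AlgebraicClosure k) hk hg hE
    (two_ne_zero_of_odd_card hk) hdeg
  have := abs_sum_le_of_eq_eval_pow hk h32 hκ (by rw [Nat.odd_iff]; omega) (by omega) _ hv
    fun s => moebius_eq _
  refine this.trans ?_
  have h2 : (Δ.natDegree : ℝ) ≤ 2 * g.natDegree := by exact_mod_cast (by omega)
  have : 0 ≤ √(Fintype.card k : ℝ) := Real.sqrt_nonneg _
  nlinarith

/-- The product of Möbius functions on two lines of different degrees has cancellation. -/
theorem abs_sum_moebius_mul_moebius_le (hk : Odd (Fintype.card k)) (h32 : 32 ≤ Fintype.card k)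
    {g f E : k[X]} (hg : g.Monic) (hf : f.Monic) (hE : Squarefree E)
    (hdeg : E.natDegree + 1 = g.natDegree) (hdeg' : E.natDegree + 2 = f.natDegree)
    (hfk : 8 * f.natDegree ≤ Fintype.card k) :
    |∑ s : k, ((moebius (g + C s * E) * moebius (f - C s * E) : ℤ) : ℝ)| ≤
      108 * f.natDegree * √(Fintype.card k) := by
  obtain ⟨Δ, κ, hκ, hΔ0, hΔ, hv⟩ := moebius_add_C_mul (AlgebraicClosure k) hk hg hE (δ := 1)
    (by simp) hdeg
  obtain ⟨Δ', κ', hκ', hΔ0', hΔ', hv'⟩ := moebius_add_C_mul (AlgebraicClosure k) hk hf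
    (E := -E) (fun x hx => hE x (dvd_neg.1 hx)) (two_ne_zero_of_odd_card hk) (by rwa [natDegree_neg])
  have hnd : (Δ * Δ').natDegree = Δ.natDegree + Δ'.natDegree := natDegree_mul hΔ0 hΔ0'
  have := abs_sum_le_of_eq_eval_pow (Δ := Δ * Δ') hk h32 (mul_ne_zero hκ hκ')
    (by rw [hnd, Nat.odd_iff]; omega) (by rw [hnd]; omega)
    (fun s => moebius (g + C s * E) * moebius (f - C s * E))
    (fun s => by
      have h1 := hv' s
      rw [mul_neg, ← sub_eq_add_neg] at h1
      rw [Int.cast_mul, hv, h1, eval_mul, mul_pow]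
      ring)
    (fun s => by
      rcases moebius_eq (g + C s * E) with h | h | h <;>
      rcases moebius_eq (f - C s * E) with h' | h' | h' <;> simp [h, h'])
  refine this.trans ?_
  have h2 : ((Δ * Δ').natDegree : ℝ) ≤ 4 * f.natDegree := by rw [hnd]; exact_mod_cast (by omega)
  have : 0 ≤ √(Fintype.card k : ℝ) := Real.sqrt_nonneg _
  nlinarith

open Classical in
/-- A line contains few polynomials which are not squarefree. -/
theorem card_not_squarefree_add_C_mul_le (hk : Odd (Fintype.card k)) {g E : k[X]} (hg : g.Monic)
    (hE : Squarefree E) {δ : ℕ} (hδ : (δ : k) ≠ 0) (hdeg : E.natDegree + δ = g.natDegree) :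
    (Finset.univ.filter fun s : k => ¬ Squarefree (g + C s * E)).card ≤ 2 * g.natDegree := by
  obtain ⟨Δ, κ, hκ, hΔ0, hΔ, hv⟩ := moebius_add_C_mul (AlgebraicClosure k) hk hg hE hδ hdeg
  refine (card_eval_algebraMap_eq_zero_le hΔ0 _ fun s hs => ?_).trans (by omega)
  have h := hv s
  rw [moebius_of_not_squarefree (Finset.mem_filter.1 hs).2, Int.cast_zero, eq_comm,
    mul_eq_zero] at h
  exact eq_zero_of_pow_eq_zero (h.resolve_left hκ)

end MoebiusSum

section MonicDeg

variable {k : Type*} [Field k] [Fintype k]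

open Classical in
/-- The finite set of monic polynomials of degree `N`. -/
noncomputable def monicDeg (k : Type*) [Field k] [Fintype k] (N : ℕ) : Finset k[X] :=
  Finset.univ.image fun v : Fin N → k => X ^ N + ((degreeLTEquiv k N).symm v : k[X])

lemma mem_monicDeg {N : ℕ} {f : k[X]} : f ∈ monicDeg k N ↔ f.Monic ∧ f.natDegree = N := by
  simp only [monicDeg, Finset.mem_image, Finset.mem_univ, true_and]
  constructor
  · rintro ⟨v, rfl⟩
    have h := mem_degreeLT.1 ((degreeLTEquiv k N).symm v).2
    exact ⟨monic_X_pow_add h, natDegree_eq_of_degree_eq_some <| by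
      rw [degree_add_eq_left_of_degree_lt (by simpa using h), degree_X_pow]⟩
  · rintro ⟨hf, rfl⟩
    have h : f - X ^ f.natDegree ∈ degreeLT k f.natDegree := by
      rw [mem_degreeLT]
      refine (degree_sub_lt_left ?_ hf.ne_zero ?_).trans_eq (degree_eq_natDegree hf.ne_zero)
      · rw [degree_X_pow, degree_eq_natDegree hf.ne_zero]
      · rw [hf.leadingCoeff, leadingCoeff_X_pow]
    exact ⟨degreeLTEquiv k _ ⟨_, h⟩, by simp⟩

lemma card_monicDeg (N : ℕ) : (monicDeg k N).card = Fintype.card k ^ N := by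
  classical
  rw [monicDeg, Finset.card_image_of_injective]
  · simp
  · intro v w h
    exact (degreeLTEquiv k N).symm.injective (Subtype.ext (add_left_cancel h))

lemma exists_monic_irreducible_mul {k : Type*} [Field k] {f : k[X]} (hf : f.Monic) (h1 : f ≠ 1) :
    ∃ P g : k[X], P.Monic ∧ Irreducible P ∧ g.Monic ∧ f = P * g ∧ g.natDegree < f.natDegree := by
  obtain ⟨P, hPm, hP, g, rfl⟩ := exists_monic_irreducible_factor f
    (fun h => h1 (hf.isUnit_iff.1 h))
  have hg := hPm.of_mul_monic_left hf
  refine ⟨P, g, hPm, hP, hg, rfl, ?_⟩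
  rw [hPm.natDegree_mul hg]
  have := hP.natDegree_pos
  omega

open Classical in
/-- The finite set of squarefree monic divisors. -/
noncomputable def sqDivs (f : k[X]) : Finset k[X] :=
  ((Finset.range (f.natDegree + 1)).biUnion (monicDeg k)).filter fun d => Squarefree d ∧ d ∣ f

lemma mem_sqDivs {f d : k[X]} (hf : f ≠ 0) :
    d ∈ sqDivs f ↔ d.Monic ∧ Squarefree d ∧ d ∣ f := by
  simp only [sqDivs, Finset.mem_filter, Finset.mem_biUnion, Finset.mem_range, mem_monicDeg]
  constructor
  · rintro ⟨⟨_, _, h, _⟩, h', h''⟩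
    exact ⟨h, h', h''⟩
  · rintro ⟨h, h', h''⟩
    exact ⟨⟨_, Nat.lt_succ_of_le (natDegree_le_of_dvd h'' hf), h, rfl⟩, h', h''⟩

lemma sqDivs_one : sqDivs (1 : k[X]) = {1} := by
  ext d
  rw [mem_sqDivs one_ne_zero, Finset.mem_singleton]
  exact ⟨fun h => h.1.isUnit_iff.1 (isUnit_of_dvd_one h.2.2),
    by rintro rfl; exact ⟨monic_one, squarefree_one, dvd_rfl⟩⟩

lemma sqDivs_mul_of_dvd {P g : k[X]} (hP : Irreducible P) (hg : g ≠ 0) (h : P ∣ g) :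
    sqDivs (P * g) = sqDivs g := by
  ext d
  rw [mem_sqDivs (mul_ne_zero hP.ne_zero hg), mem_sqDivs hg]
  refine and_congr_right fun _ => and_congr_right fun hd => ⟨fun hdv => ?_, fun h => h.mul_left P⟩
  by_cases hPd : P ∣ d
  · obtain ⟨e, rfl⟩ := hPd
    have he : e ∣ g := (mul_dvd_mul_iff_left hP.ne_zero).1 hdv
    have hc : IsCoprime P e := hP.coprime_iff_not_dvd.2 fun hPe =>
      hP.not_isUnit (hd P (mul_dvd_mul_left P hPe))
    exact hc.mul_dvd h he
  · exact (hP.coprime_iff_not_dvd.2 hPd).symm.dvd_of_dvd_mul_left hdv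

open Classical in
lemma sqDivs_mul_of_not_dvd {P g : k[X]} (hPm : P.Monic) (hP : Irreducible P) (hg : g ≠ 0)
    (h : ¬ P ∣ g) :
    sqDivs (P * g) = (sqDivs g).disjUnion ((sqDivs g).image (P * ·)) (by
      rw [Finset.disjoint_left]
      intro d hd hd'
      obtain ⟨e, -, rfl⟩ := Finset.mem_image.1 hd'
      exact h ((dvd_mul_right P e).trans ((mem_sqDivs hg).1 hd).2.2)) := by
  ext d
  rw [Finset.mem_disjUnion, Finset.mem_image, mem_sqDivs (mul_ne_zero hP.ne_zero hg),
    mem_sqDivs hg]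
  constructor
  · rintro ⟨hm, hd, hdv⟩
    by_cases hPd : P ∣ d
    · obtain ⟨e, rfl⟩ := hPd
      exact Or.inr ⟨e, (mem_sqDivs hg).2 ⟨hPm.of_mul_monic_left hm,
        hd.squarefree_of_dvd (dvd_mul_left e P), (mul_dvd_mul_iff_left hP.ne_zero).1 hdv⟩, rfl⟩
    · exact Or.inl ⟨hm, hd, (hP.coprime_iff_not_dvd.2 hPd).symm.dvd_of_dvd_mul_left hdv⟩
  · rintro (⟨hm, hd, hdv⟩ | ⟨e, he, rfl⟩)
    · exact ⟨hm, hd, hdv.mul_left P⟩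
    · obtain ⟨hm, hd, hdv⟩ := (mem_sqDivs hg).1 he
      refine ⟨hPm.mul hm, ?_, mul_dvd_mul_left P hdv⟩
      rw [squarefree_mul_iff]
      exact ⟨(hP.coprime_iff_not_dvd.2 fun h' => h (h'.trans hdv)).isRelPrime, hP.squarefree, hd⟩

lemma card_sqDivs_le {f : k[X]} (hf : f.Monic) : (sqDivs f).card ≤ 2 ^ f.natDegree := by
  classical
  induction hN : f.natDegree using Nat.strong_induction_on generalizing f with
  | _ N ih =>
    subst hN
    by_cases h1 : f = 1
    · simp [h1, sqDivs_one]
    obtain ⟨P, g, hPm, hP, hg, rfl, hlt⟩ := exists_monic_irreducible_mul hf h1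
    have := ih _ hlt hg rfl
    have h2 : 2 ^ (g.natDegree + 1) ≤ 2 ^ (P * g).natDegree := Nat.pow_le_pow_right (by simp) hlt
    rw [pow_succ] at h2
    by_cases h : P ∣ g
    · rw [sqDivs_mul_of_dvd hP hg.ne_zero h]
      omega
    · rw [sqDivs_mul_of_not_dvd hPm hP hg.ne_zero h, Finset.card_disjUnion]
      have := Finset.card_image_le (s := sqDivs g) (f := (P * ·))
      omega

/-- The generating polynomial of the Möbius function over the divisors of `f`. -/
noncomputable def moebiusPoly (f : k[X]) : ℤ[X] :=
  ∑ d ∈ sqDivs f, C (moebius d) * X ^ d.natDegree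

lemma moebiusPoly_one : moebiusPoly (1 : k[X]) = 1 := by
  simp [moebiusPoly, sqDivs_one, moebius_one]

lemma moebiusPoly_mul_of_not_dvd {P g : k[X]} (hPm : P.Monic) (hP : Irreducible P) (hg : g ≠ 0)
    (h : ¬ P ∣ g) : moebiusPoly (P * g) = (1 - X ^ P.natDegree) * moebiusPoly g := by
  classical
  rw [moebiusPoly, sqDivs_mul_of_not_dvd hPm hP hg h, Finset.sum_disjUnion,
    Finset.sum_image fun a _ b _ hab => mul_left_cancel₀ hP.ne_zero hab, sub_mul, one_mul,
    sub_eq_add_neg, moebiusPoly, Finset.mul_sum, ← Finset.sum_neg_distrib]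
  congr 1
  refine Finset.sum_congr rfl fun d hd => ?_
  obtain ⟨hm, -, hdv⟩ := (mem_sqDivs hg).1 hd
  rw [moebius_irreducible_mul hP hm.ne_zero fun h' => h (h'.trans hdv), hPm.natDegree_mul hm,
    pow_add, C_neg]
  ring

lemma eval_one_moebiusPoly {f : k[X]} (hf : f.Monic) (h1 : f ≠ 1) :
    (moebiusPoly f).eval 1 = 0 := by
  induction hN : f.natDegree using Nat.strong_induction_on generalizing f with
  | _ N ih =>
    subst hN
    obtain ⟨P, g, hPm, hP, hg, rfl, hlt⟩ := exists_monic_irreducible_mul hf h1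
    by_cases h : P ∣ g
    · rw [moebiusPoly, sqDivs_mul_of_dvd hP hg.ne_zero h]
      refine ih _ hlt hg ?_ rfl
      rintro rfl
      exact hP.not_isUnit (isUnit_of_dvd_one h)
    · simp [moebiusPoly_mul_of_not_dvd hPm hP hg.ne_zero h]

lemma natDegree_moebiusPoly_le {f : k[X]} (hf : f ≠ 0) :
    (moebiusPoly f).natDegree ≤ f.natDegree := by
  refine natDegree_sum_le_of_forall_le _ _ fun d hd => ?_
  exact (natDegree_C_mul_X_pow_le _ _).trans (natDegree_le_of_dvd ((mem_sqDivs hf).1 hd).2.2 hf)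

lemma reflect_moebiusPoly {f : k[X]} (hf : f.Monic) (hs : Squarefree f) :
    reflect f.natDegree (moebiusPoly f) = C (moebius f) * moebiusPoly f := by
  induction hN : f.natDegree using Nat.strong_induction_on generalizing f with
  | _ N ih =>
    subst hN
    by_cases h1 : f = 1
    · simp [h1, moebiusPoly_one, moebius_one]
    obtain ⟨P, g, hPm, hP, hg, rfl, hlt⟩ := exists_monic_irreducible_mul hf h1
    have h : ¬ P ∣ g := fun h => hP.not_isUnit (hs P (mul_dvd_mul_left P h))
    rw [moebiusPoly_mul_of_not_dvd hPm hP hg.ne_zero h, hPm.natDegree_mul hg,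
      reflect_mul _ _ (by compute_degree) (natDegree_moebiusPoly_le hg.ne_zero),
      ih _ hlt hg (hs.squarefree_of_dvd (dvd_mul_left g P)) rfl,
      moebius_irreducible_mul hP hg.ne_zero h, C_neg]
    have : reflect P.natDegree (1 - X ^ P.natDegree : ℤ[X]) = X ^ P.natDegree - 1 := by
      rw [reflect_sub, reflect_one, reflect_monomial, revAt_le le_rfl, Nat.sub_self, pow_zero]
    rw [this]
    ring

open Classical in
lemma eval_one_derivative_moebiusPoly {f : k[X]} (hf : f.Monic) (hs : Squarefree f) (h1 : f ≠ 1) :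
    (derivative (moebiusPoly f)).eval 1 = if Irreducible f then -(f.natDegree : ℤ) else 0 := by
  obtain ⟨P, g, hPm, hP, hg, rfl, -⟩ := exists_monic_irreducible_mul hf h1
  have h : ¬ P ∣ g := fun h => hP.not_isUnit (hs P (mul_dvd_mul_left P h))
  rw [moebiusPoly_mul_of_not_dvd hPm hP hg.ne_zero h]
  by_cases hg1 : g = 1
  · simp [hg1, hP, moebiusPoly_one, derivative_X_pow]
  · have : ¬ Irreducible (P * g) := fun hi =>
      (hi.isUnit_or_isUnit rfl).elim hP.not_isUnit fun hu => hg1 (hg.isUnit_iff.1 hu)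
    simp [this, eval_one_moebiusPoly hg hg1]

/-- The Möbius function summed over the divisors of degree at most `m`. -/
noncomputable def truncSum (f : k[X]) (m : ℕ) : ℤ :=
  ∑ d ∈ sqDivs f with d.natDegree ≤ m, moebius d

lemma truncSum_eq_sum_coeff (f : k[X]) (m : ℕ) :
    truncSum f m = ∑ j ∈ Finset.range (m + 1), (moebiusPoly f).coeff j := by
  simp only [moebiusPoly, finsetSum_coeff, coeff_C_mul_X_pow]
  rw [Finset.sum_comm, truncSum, Finset.sum_filter]
  refine Finset.sum_congr rfl fun d _ => ?_
  simp

lemma abs_truncSum_le {f : k[X]} (hf : f.Monic) (m : ℕ) : |truncSum f m| ≤ 2 ^ f.natDegree := by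
  refine (Finset.abs_sum_le_sum_abs _ _).trans ?_
  refine (Finset.sum_le_card_nsmul _ _ 1 fun d _ => ?_).trans ?_
  · rcases moebius_eq d with h | h | h <;> simp [h]
  · rw [nsmul_eq_mul, mul_one]
    exact_mod_cast (Finset.card_filter_le _ _).trans (card_sqDivs_le hf)

lemma truncSum_natDegree {f : k[X]} (hf : f.Monic) (h1 : f ≠ 1) {m : ℕ} (hm : f.natDegree ≤ m) :
    truncSum f m = 0 := by
  have h := eval_one_moebiusPoly hf h1
  rw [eval_eq_sum_range' (Nat.lt_succ_of_le ((natDegree_moebiusPoly_le hf.ne_zero).trans hm))] at h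
  simpa [truncSum_eq_sum_coeff] using h

lemma truncSum_reflect {f : k[X]} (hf : f.Monic) (hs : Squarefree f) {i j : ℕ}
    (hij : i + j + 1 = f.natDegree) : truncSum f i = -moebius f * truncSum f j := by
  have h1 : f ≠ 1 := by rintro rfl; simp at hij
  have h0 := truncSum_natDegree hf h1 le_rfl
  have hc : ∀ a ≤ f.natDegree,
      (moebiusPoly f).coeff (f.natDegree - a) = moebius f * (moebiusPoly f).coeff a := by
    intro a ha
    rw [← coeff_C_mul, ← reflect_moebiusPoly hf hs, coeff_reflect, revAt_le ha]
  rw [truncSum_eq_sum_coeff, ← hij, show i + j + 1 + 1 = (j + 1) + (i + 1) by ring,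
    Finset.sum_range_add] at h0
  have h2 : ∑ x ∈ Finset.range (i + 1), (moebiusPoly f).coeff (j + 1 + x) =
      ∑ x ∈ Finset.range (i + 1), moebius f * (moebiusPoly f).coeff x := by
    rw [← Finset.sum_range_reflect]
    refine Finset.sum_congr rfl fun x hx => ?_
    have hx := Finset.mem_range.1 hx
    rw [← hc x (by omega)]
    congr 1
    omega
  rw [h2, ← Finset.mul_sum, ← truncSum_eq_sum_coeff, ← truncSum_eq_sum_coeff] at h0
  rcases moebius_of_squarefree hs with h | h <;> rw [h] at h0 ⊢ <;> linarith

lemma sum_range_sum_range_succ (c : ℕ → ℤ) (N : ℕ) :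
    ∑ m ∈ Finset.range N, ∑ j ∈ Finset.range (m + 1), c j =
      ∑ j ∈ Finset.range (N + 1), (N - j : ℤ) * c j := by
  induction N with
  | zero => simp
  | succ N ih =>
    rw [Finset.sum_range_succ, ih, Finset.sum_range_succ _ (N + 1), ← Finset.sum_add_distrib]
    simp only [sub_self, zero_mul, add_zero]
    exact Finset.sum_congr rfl fun j _ => by push_cast; ring

open Classical in
lemma sum_truncSum {f : k[X]} (hf : f.Monic) (hs : Squarefree f) (h1 : f ≠ 1) :
    ∑ m ∈ Finset.range f.natDegree, truncSum f m =
      if Irreducible f then (f.natDegree : ℤ) else 0 := by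
  have hlt := Nat.lt_succ_of_le (natDegree_moebiusPoly_le hf.ne_zero)
  have h := eval_one_moebiusPoly hf h1
  have h' := eval_one_derivative_moebiusPoly hf hs h1
  rw [eval_eq_sum_range' hlt] at h
  rw [derivative_eval, sum_over_range' _ (by simp) _ hlt] at h'
  simp only [truncSum_eq_sum_coeff, sum_range_sum_range_succ, sub_mul, Finset.sum_sub_distrib]
  simp only [one_pow, mul_one] at h h'
  rw [← Finset.mul_sum, h, mul_zero, zero_sub, Finset.sum_congr rfl fun j _ => mul_comm _ _, h']
  split_ifs <;> simp

end MonicDeg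

section Counting

variable {k : Type*} [Field k] [Fintype k]

open Classical in
/-- The number of monic polynomials of degree `N` in a residue class. -/
lemma card_monicDeg_dvd_sub {P : k[X]} (hP : P.Monic) (c : k[X]) {N : ℕ} (hN : P.natDegree ≤ N) :
    ((monicDeg k N).filter fun g => P ∣ g - c).card = Fintype.card k ^ (N - P.natDegree) := by
  have hlt : ∀ u ∈ monicDeg k (N - P.natDegree), (c %ₘ P).degree < (P * u).degree := by
    intro u hu
    obtain ⟨hu, -⟩ := mem_monicDeg.1 hu
    exact (degree_modByMonic_lt c hP).trans_le (degree_le_mul_left P hu.ne_zero)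
  rw [← card_monicDeg, eq_comm]
  refine Finset.card_bij (fun u _ => P * u + c %ₘ P) ?_ ?_ ?_
  · intro u hu
    have hlt := hlt u hu
    obtain ⟨hu, hud⟩ := mem_monicDeg.1 hu
    rw [Finset.mem_filter, mem_monicDeg]
    refine ⟨⟨(hP.mul hu).add_of_left hlt, ?_⟩, ?_⟩
    · rw [natDegree_add_eq_left_of_degree_lt hlt, hP.natDegree_mul hu]
      omega
    · have h := modByMonic_add_div c P
      exact ⟨u - c /ₘ P, by linear_combination h⟩
  · intro u _ v _ h
    exact mul_left_cancel₀ hP.ne_zero (add_right_cancel h)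
  · intro g hg
    rw [Finset.mem_filter, mem_monicDeg] at hg
    obtain ⟨⟨hg, hgd⟩, w, hw⟩ := hg
    have h := modByMonic_add_div c P
    have hlt : (c %ₘ P).degree < g.degree := (degree_modByMonic_lt c hP).trans_le <| by
      rw [degree_eq_natDegree hP.ne_zero, degree_eq_natDegree hg.ne_zero, hgd]
      exact_mod_cast hN
    have hgP : g - c %ₘ P = P * (w + c /ₘ P) := by linear_combination hw - h
    have hm : (P * (w + c /ₘ P)).Monic := hgP ▸ hg.sub_of_left hlt
    have hu := hP.of_mul_monic_left hm
    refine ⟨w + c /ₘ P, mem_monicDeg.2 ⟨hu, ?_⟩, by rw [← hgP]; ring⟩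
    have := hP.natDegree_mul hu
    rw [← hgP, natDegree_eq_of_degree_eq (degree_sub_eq_left_of_degree_lt hlt)] at this
    omega

open Classical in
lemma card_monicDeg_dvd_mul_le {P : k[X]} (hP : P.Monic) (h1 : P ≠ 1) (N : ℕ) :
    ((monicDeg k N).filter fun g => P ∣ g).card * Fintype.card k ≤ Fintype.card k ^ N := by
  have hpos : 0 < P.natDegree := by
    rw [Nat.pos_iff_ne_zero]
    exact fun h => h1 (hP.natDegree_eq_zero.1 h)
  rcases le_or_gt P.natDegree N with h | h
  · have := card_monicDeg_dvd_sub hP 0 h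
    simp only [sub_zero] at this
    rw [this, ← pow_succ]
    exact Nat.pow_le_pow_right Fintype.card_pos (by omega)
  · rw [Finset.filter_false_of_mem, Finset.card_empty, zero_mul]
    · exact Nat.zero_le _
    intro g hg hPg
    obtain ⟨hg, hgd⟩ := mem_monicDeg.1 hg
    have := natDegree_le_of_dvd hPg hg.ne_zero
    omega

open Classical in
lemma card_monicDeg_not_isCoprime_mul_le {F : k[X]} (hF : F.Monic) (N : ℕ) :
    ((monicDeg k N).filter fun g => ¬ IsCoprime g F).card * Fintype.card k ≤
      2 ^ F.natDegree * Fintype.card k ^ N := by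
  have hsub : ((monicDeg k N).filter fun g => ¬ IsCoprime g F) ⊆
      ((sqDivs F).filter (· ≠ 1)).biUnion fun P => (monicDeg k N).filter fun g => P ∣ g := by
    intro g hg
    rw [Finset.mem_filter] at hg
    have hnu : ¬ IsUnit (EuclideanDomain.gcd g F) := fun h =>
      hg.2 (EuclideanDomain.gcd_isUnit_iff.1 h)
    obtain ⟨P, hPm, hP, hdvd⟩ := exists_monic_irreducible_factor _ hnu
    simp only [Finset.mem_biUnion, Finset.mem_filter]
    exact ⟨P, ⟨(mem_sqDivs hF.ne_zero).2 ⟨hPm, hP.squarefree,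
      hdvd.trans (EuclideanDomain.gcd_dvd_right g F)⟩, hP.ne_one⟩, hg.1,
      hdvd.trans (EuclideanDomain.gcd_dvd_left g F)⟩
  calc _ ≤ (∑ P ∈ (sqDivs F).filter (· ≠ 1),
        ((monicDeg k N).filter fun g => P ∣ g).card) * Fintype.card k :=
        Nat.mul_le_mul_right _ ((Finset.card_le_card hsub).trans Finset.card_biUnion_le)
    _ ≤ ∑ P ∈ (sqDivs F).filter (· ≠ 1), Fintype.card k ^ N := by
        rw [Finset.sum_mul]
        refine Finset.sum_le_sum fun P hP => ?_
        rw [Finset.mem_filter, mem_sqDivs hF.ne_zero] at hP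
        exact card_monicDeg_dvd_mul_le hP.1.1 hP.2 N
    _ ≤ _ := by
        rw [Finset.sum_const, smul_eq_mul]
        exact Nat.mul_le_mul_right _ ((Finset.card_filter_le _ _).trans (card_sqDivs_le hF))

open Classical in
/-- The monic polynomials `g` of degree `N` with `d ∣ g` and `e ∣ F - g`. -/
noncomputable def commonMultiples (F : k[X]) (N : ℕ) (d e : k[X]) : Finset k[X] :=
  (monicDeg k N).filter fun g => d ∣ g ∧ e ∣ F - g

open Classical in
lemma mem_commonMultiples {F d e g : k[X]} {N : ℕ} :
    g ∈ commonMultiples F N d e ↔ (g.Monic ∧ g.natDegree = N) ∧ d ∣ g ∧ e ∣ F - g := by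
  rw [commonMultiples, Finset.mem_filter, mem_monicDeg]

open Classical in
lemma card_commonMultiples {F d e : k[X]} (hd : d.Monic) (he : e.Monic) (hde : IsCoprime d e)
    {N : ℕ} (hN : d.natDegree + e.natDegree ≤ N) :
    (commonMultiples F N d e).card = Fintype.card k ^ (N - (d.natDegree + e.natDegree)) := by
  obtain ⟨u, v, huv⟩ := hde
  rw [← hd.natDegree_mul he, ← card_monicDeg_dvd_sub (hd.mul he) (u * d * F)
    (by rwa [hd.natDegree_mul he]), commonMultiples]
  congr 1
  refine Finset.filter_congr fun g _ => ⟨fun ⟨h1, h2⟩ => ?_, fun h => ⟨?_, ?_⟩⟩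
  · refine IsCoprime.mul_dvd ⟨u, v, huv⟩ ?_ ?_
    · exact dvd_sub h1 ⟨u * F, by ring⟩
    · have : g - u * d * F = e * (v * F) - (F - g) := by linear_combination -F * huv
      rw [this]
      exact dvd_sub (dvd_mul_right _ _) h2
  · have := ((dvd_mul_right d e).trans h).add (⟨u * F, by ring⟩ : d ∣ u * d * F)
    rwa [sub_add_cancel] at this
  · have : F - g = e * (v * F) - (g - u * d * F) := by linear_combination -F * huv
    rw [this]
    exact dvd_sub (dvd_mul_right _ _) ((dvd_mul_left e d).trans h)

open Classical in
/-- The finite set of monic polynomials of degree at most `m`. -/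
noncomputable def monicLE (k : Type*) [Field k] [Fintype k] (m : ℕ) : Finset k[X] :=
  (Finset.range (m + 1)).biUnion (monicDeg k)

lemma mem_monicLE {m : ℕ} {d : k[X]} : d ∈ monicLE k m ↔ d.Monic ∧ d.natDegree ≤ m := by
  simp only [monicLE, Finset.mem_biUnion, Finset.mem_range, mem_monicDeg]
  exact ⟨fun ⟨a, h, h', h''⟩ => ⟨h', by omega⟩, fun ⟨h, h'⟩ => ⟨_, by omega, h, rfl⟩⟩

lemma sum_monicLE (m : ℕ) (φ : k[X] → ℝ) :
    ∑ d ∈ monicLE k m, φ d = ∑ a ∈ Finset.range (m + 1), ∑ d ∈ monicDeg k a, φ d := by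
  classical
  rw [monicLE, Finset.sum_biUnion]
  intro a _ b _ hab
  rw [Function.onFun, Finset.disjoint_left]
  intro d ha hb
  exact hab ((mem_monicDeg.1 ha).2.symm.trans (mem_monicDeg.1 hb).2)

open Classical in
lemma truncSum_eq_sum_monicLE {f : k[X]} (hf : f ≠ 0) (m : ℕ) :
    (truncSum f m : ℝ) = ∑ d ∈ monicLE k m, if d ∣ f then (moebius d : ℝ) else 0 := by
  rw [truncSum, Int.cast_sum, ← Finset.sum_filter]
  refine Finset.sum_subset_zero_on_sdiff ?_ ?_ fun _ _ => rfl
  · intro d hd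
    rw [Finset.mem_filter, mem_sqDivs hf] at hd
    rw [Finset.mem_filter, mem_monicLE]
    exact ⟨⟨hd.1.1, hd.2⟩, hd.1.2.2⟩
  · intro d hd
    rw [Finset.mem_sdiff, Finset.mem_filter, mem_monicLE, Finset.mem_filter, mem_sqDivs hf] at hd
    rw [moebius_of_not_squarefree, Int.cast_zero]
    exact fun h => hd.2 ⟨⟨hd.1.1.1, h, hd.1.2⟩, hd.1.1.2⟩

/-- The truncated logarithmic density of the Möbius function. -/
lemma sum_monicLE_moebius_div (m : ℕ) :
    ∑ d ∈ monicLE k m, (moebius d : ℝ) / (Fintype.card k : ℝ) ^ d.natDegree =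
      if m = 0 then 1 else 0 := by
  classical
  have hq : (Fintype.card k : ℝ) ≠ 0 := by exact_mod_cast Fintype.card_ne_zero
  have h : ∑ f ∈ monicDeg k m, (truncSum f m : ℝ) = (Fintype.card k : ℝ) ^ m *
      ∑ d ∈ monicLE k m, (moebius d : ℝ) / (Fintype.card k : ℝ) ^ d.natDegree := by
    rw [Finset.sum_congr rfl fun f hf =>
      truncSum_eq_sum_monicLE (mem_monicDeg.1 hf).1.ne_zero m, Finset.sum_comm, Finset.mul_sum]
    refine Finset.sum_congr rfl fun d hd => ?_
    obtain ⟨hd, hdm⟩ := mem_monicLE.1 hd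
    have := card_monicDeg_dvd_sub hd 0 hdm
    simp only [sub_zero] at this
    rw [← Finset.sum_filter, Finset.sum_const, this, nsmul_eq_mul, Nat.cast_pow,
      pow_sub₀ _ hq hdm]
    ring
  split_ifs with hm
  · subst hm
    rw [sum_monicLE]
    have : monicDeg k 0 = {1} := by
      ext f
      rw [mem_monicDeg, Finset.mem_singleton]
      exact ⟨fun h => h.1.natDegree_eq_zero.1 h.2, by rintro rfl; simp⟩
    simp [this, moebius_one]
  · rw [Finset.sum_eq_zero] at h
    · exact (mul_eq_zero.1 h.symm).resolve_left (pow_ne_zero _ hq)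
    · intro f hf
      obtain ⟨hf, hfm⟩ := mem_monicDeg.1 hf
      rw [truncSum_natDegree hf _ hfm.le, Int.cast_zero]
      rintro rfl
      exact hm (by simpa using hfm.symm)

end Counting

section Averaging

variable {k : Type*} [Field k] [Fintype k]

lemma sub_mem_monicDeg {F g : k[X]} {N : ℕ} (hF : F ∈ monicDeg k (N + 1))
    (hg : g ∈ monicDeg k N) : F - g ∈ monicDeg k (N + 1) := by
  rw [mem_monicDeg] at *
  have hlt : g.degree < F.degree := by
    rw [degree_eq_natDegree hg.1.ne_zero, degree_eq_natDegree hF.1.ne_zero, hg.2, hF.2]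
    exact_mod_cast N.lt_succ_self
  exact ⟨hF.1.sub_of_left hlt,
    (natDegree_eq_of_degree_eq (degree_sub_eq_left_of_degree_lt hlt)).trans hF.2⟩

lemma add_C_mul_mem_monicDeg {g E : k[X]} {N : ℕ} (hE : E.natDegree < N)
    (hg : g ∈ monicDeg k N) (s : k) : g + C s * E ∈ monicDeg k N := by
  rw [mem_monicDeg] at *
  have hlt : (C s * E).degree < g.degree := by
    rw [degree_eq_natDegree hg.1.ne_zero, hg.2]
    exact degree_le_natDegree.trans_lt
      (by exact_mod_cast (natDegree_C_mul_le s E).trans_lt hE)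
  exact ⟨hg.1.add_of_left hlt, (natDegree_add_eq_left_of_degree_lt hlt).trans hg.2⟩

omit [Fintype k] in
lemma exists_squarefree_dvd_dvd {d e : k[X]} (hd : Squarefree d) (he : Squarefree e) :
    ∃ M : k[X], Squarefree M ∧ d ∣ M ∧ e ∣ M ∧ M.natDegree ≤ d.natDegree + e.natDegree := by
  classical
  have hde : d * e ≠ 0 := mul_ne_zero hd.ne_zero he.ne_zero
  refine ⟨UniqueFactorizationMonoid.radical (d * e),
    UniqueFactorizationMonoid.squarefree_radical, ?_, ?_, ?_⟩
  · exact (UniqueFactorizationMonoid.dvd_radical_iff hd.isRadical hde).2 (dvd_mul_right d e)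
  · exact (UniqueFactorizationMonoid.dvd_radical_iff he.isRadical hde).2 (dvd_mul_left e d)
  · exact (natDegree_le_of_dvd UniqueFactorizationMonoid.radical_dvd_self hde).trans
      natDegree_mul_le

lemma exists_squarefree_natDegree_eq {M : k[X]} (hM : Squarefree M) {D : ℕ}
    (hMD : M.natDegree ≤ D) (hD : D ≤ Fintype.card k) :
    ∃ E : k[X], Squarefree E ∧ M ∣ E ∧ E.natDegree = D := by
  induction D, hMD using Nat.le_induction with
  | base => exact ⟨M, hM, dvd_rfl, rfl⟩
  | succ D _ ih =>
    obtain ⟨E, hE, hME, hED⟩ := ih (by omega)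
    obtain ⟨τ, hτ⟩ : ∃ τ : k, ¬ E.IsRoot τ := by
      by_contra! h
      have h1 := card_le_degree_of_subset_roots (p := E) (Z := Finset.univ)
        fun τ _ => (mem_roots hE.ne_zero).2 (h τ)
      rw [Finset.card_univ] at h1
      omega
    refine ⟨E * (X - C τ), ?_, hME.mul_right _, ?_⟩
    · rw [squarefree_mul_iff]
      refine ⟨?_, hE, (irreducible_X_sub_C τ).squarefree⟩
      exact (((irreducible_X_sub_C τ).coprime_iff_not_dvd).2
        fun h => hτ (dvd_iff_isRoot.1 h)).symm.isRelPrime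
    · rw [natDegree_mul hE.ne_zero (X_sub_C_ne_zero τ), natDegree_X_sub_C, hED]

/-- Averaging over the lines with a fixed direction. -/
lemma card_mul_sum_eq_sum_line (S : Finset k[X]) (E : k[X])
    (hS : ∀ g ∈ S, ∀ s : k, g + C s * E ∈ S) (φ : k[X] → ℝ) :
    (Fintype.card k : ℝ) * ∑ g ∈ S, φ g = ∑ g ∈ S, ∑ s : k, φ (g + C s * E) := by
  have h : ∀ s : k, ∑ g ∈ S, φ (g + C s * E) = ∑ g ∈ S, φ g := by
    intro s
    refine Finset.sum_bij (fun g _ => g + C s * E) (fun g hg => hS g hg s)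
      (fun _ _ _ _ h => add_right_cancel h) (fun g hg => ?_) (fun _ _ => rfl)
    exact ⟨g + C (-s) * E, hS g hg _, by rw [C_neg]; ring⟩
  rw [Finset.sum_comm, Finset.sum_congr rfl fun s _ => h s, Finset.sum_const, nsmul_eq_mul,
    Finset.card_univ]

open Classical in
lemma sum_monicLE_mul_sum_monicLE (F : k[X]) (N i j : ℕ) (w φ : k[X] → ℝ) :
    ∑ g ∈ monicDeg k N, (∑ d ∈ monicLE k i, if d ∣ g then w d else 0) *
        (∑ e ∈ monicLE k j, if e ∣ F - g then w e else 0) * φ g =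
      ∑ d ∈ monicLE k i, ∑ e ∈ monicLE k j,
        w d * w e * ∑ g ∈ commonMultiples F N d e, φ g := by
  simp only [Finset.sum_mul, Finset.mul_sum]
  rw [Finset.sum_comm (s := monicLE k i), Finset.sum_comm (s := monicDeg k N)]
  refine Finset.sum_congr rfl fun e _ => ?_
  rw [Finset.sum_comm]
  refine Finset.sum_congr rfl fun d _ => ?_
  rw [commonMultiples, Finset.sum_filter]
  refine Finset.sum_congr rfl fun g _ => ?_
  by_cases h1 : d ∣ g <;> by_cases h2 : e ∣ F - g <;> simp [h1, h2]

lemma sum_truncSum_mul_truncSum {F : k[X]} {N : ℕ} (hF : F ∈ monicDeg k (N + 1)) (i j : ℕ)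
    (φ : k[X] → ℝ) :
    ∑ g ∈ monicDeg k N, (truncSum g i : ℝ) * truncSum (F - g) j * φ g =
      ∑ d ∈ monicLE k i, ∑ e ∈ monicLE k j,
        (moebius d : ℝ) * moebius e * ∑ g ∈ commonMultiples F N d e, φ g := by
  rw [← sum_monicLE_mul_sum_monicLE]
  refine Finset.sum_congr rfl fun g hg => ?_
  rw [truncSum_eq_sum_monicLE (mem_monicDeg.1 hg).1.ne_zero,
    truncSum_eq_sum_monicLE (mem_monicDeg.1 (sub_mem_monicDeg hF hg)).1.ne_zero]

open Classical in
lemma sum_abs_moebius_le {f : k[X]} (hf : f.Monic) (m : ℕ) :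
    ∑ d ∈ monicLE k m, (if d ∣ f then |(moebius d : ℝ)| else 0) ≤ 2 ^ f.natDegree := by
  rw [← Finset.sum_filter]
  calc _ ≤ ∑ d ∈ sqDivs f, (1 : ℝ) := by
        refine (Finset.sum_le_sum fun d _ => ?_).trans_eq
          (Finset.sum_subset_zero_on_sdiff (s₁ := sqDivs f ∩ (monicLE k m).filter (· ∣ f))
            (f := fun d => |(moebius d : ℝ)|) Finset.inter_subset_right ?_ fun _ _ => rfl).symm
            |>.trans ?_
        · exact le_rfl
        · intro d hd
          rw [Finset.mem_sdiff, Finset.mem_inter, mem_sqDivs hf.ne_zero, Finset.mem_filter,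
            mem_monicLE] at hd
          rw [moebius_of_not_squarefree, Int.cast_zero, abs_zero]
          exact fun h => hd.2 ⟨⟨hd.1.1.1, h, hd.1.2⟩, hd.1⟩
        · refine (Finset.sum_le_sum fun d _ => ?_).trans
            (Finset.sum_le_sum_of_subset_of_nonneg Finset.inter_subset_left
              fun _ _ _ => zero_le_one)
          rcases moebius_eq d with h | h | h <;> simp [h]
    _ ≤ _ := by
        rw [Finset.sum_const, nsmul_eq_mul, mul_one]
        exact_mod_cast card_sqDivs_le hf

lemma sum_abs_moebius_mul_le {F : k[X]} {N : ℕ} (hF : F ∈ monicDeg k (N + 1)) (i j : ℕ)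
    {φ : k[X] → ℝ} (hφ : ∀ g, 0 ≤ φ g) :
    ∑ d ∈ monicLE k i, ∑ e ∈ monicLE k j,
        |(moebius d : ℝ)| * |(moebius e : ℝ)| * ∑ g ∈ commonMultiples F N d e, φ g ≤
      2 ^ (2 * N + 1) * ∑ g ∈ monicDeg k N, φ g := by
  classical
  rw [← sum_monicLE_mul_sum_monicLE F N i j (fun d => |(moebius d : ℝ)|), Finset.mul_sum]
  refine Finset.sum_le_sum fun g hg => mul_le_mul_of_nonneg_right ?_ (hφ g)
  obtain ⟨hf, hfd⟩ := mem_monicDeg.1 (sub_mem_monicDeg hF hg)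
  obtain ⟨hg, hgd⟩ := mem_monicDeg.1 hg
  rw [show 2 * N + 1 = N + (N + 1) by ring, pow_add]
  have h1 := sum_abs_moebius_le hg i
  have h2 := sum_abs_moebius_le hf j
  rw [hgd] at h1
  rw [hfd] at h2
  exact mul_le_mul h1 h2 (Finset.sum_nonneg fun d _ => by split_ifs <;> positivity)
    (by positivity)

/-- Truncated divisor sums inherit cancellation on lines. -/
theorem card_mul_abs_sum_truncSum_le {F : k[X]} {N : ℕ} (hF : F ∈ monicDeg k (N + 1))
    {i j D : ℕ} (hij : i + j ≤ D) (hDN : D < N) (hD : D ≤ Fintype.card k) {φ : k[X] → ℝ} {B : ℝ}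
    (hφ : ∀ E : k[X], Squarefree E → E.natDegree = D → ∀ g ∈ monicDeg k N,
      |∑ s : k, φ (g + C s * E)| ≤ B) :
    Fintype.card k * |∑ g ∈ monicDeg k N, (truncSum g i : ℝ) * truncSum (F - g) j * φ g| ≤
      2 ^ (2 * N + 1) * (Fintype.card k ^ N * B) := by
  have key : ∀ d ∈ monicLE k i, ∀ e ∈ monicLE k j,
      (Fintype.card k : ℝ) * |(moebius d : ℝ) * moebius e *
        ∑ g ∈ commonMultiples F N d e, φ g| ≤
      |(moebius d : ℝ)| * |(moebius e : ℝ)| * ∑ g ∈ commonMultiples F N d e, B := by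
    intro d hd e he
    by_cases hds : Squarefree d
    swap
    · simp [moebius_of_not_squarefree hds]
    by_cases hes : Squarefree e
    swap
    · simp [moebius_of_not_squarefree hes]
    obtain ⟨M, hM, hdM, heM, hMd⟩ := exists_squarefree_dvd_dvd hds hes
    have h1 := (mem_monicLE.1 hd).2
    have h2 := (mem_monicLE.1 he).2
    obtain ⟨E, hE, hME, hED⟩ := exists_squarefree_natDegree_eq hM (by omega) hD
    have hS : ∀ g ∈ commonMultiples F N d e, ∀ s : k,
        g + C s * E ∈ commonMultiples F N d e := by
      intro g hg s
      rw [mem_commonMultiples, ← mem_monicDeg] at hg ⊢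
      refine ⟨add_C_mul_mem_monicDeg (by omega) hg.1 s,
        hg.2.1.add ((hdM.trans hME).mul_left _), ?_⟩
      rw [← sub_sub]
      exact hg.2.2.sub ((heM.trans hME).mul_left _)
    rw [abs_mul, abs_mul, mul_left_comm]
    refine mul_le_mul_of_nonneg_left ?_ (by positivity)
    rw [← Nat.abs_cast (Fintype.card k), ← abs_mul, card_mul_sum_eq_sum_line _ E hS]
    refine (Finset.abs_sum_le_sum_abs _ _).trans (Finset.sum_le_sum fun g hg => ?_)
    exact hφ E hE hED g (mem_monicDeg.2 (mem_commonMultiples.1 hg).1)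
  have hB : 0 ≤ B := by
    obtain ⟨E, hE, -, hED⟩ := exists_squarefree_natDegree_eq (k := k) squarefree_one
      (by simp) hD
    exact (abs_nonneg _).trans (hφ E hE hED (X ^ N)
      (mem_monicDeg.2 ⟨monic_X_pow N, natDegree_X_pow N⟩))
  rw [sum_truncSum_mul_truncSum hF]
  calc _ ≤ ∑ d ∈ monicLE k i, ∑ e ∈ monicLE k j, (Fintype.card k : ℝ) *
        |(moebius d : ℝ) * moebius e * ∑ g ∈ commonMultiples F N d e, φ g| := by
        rw [← Finset.sum_congr rfl fun d _ => Finset.mul_sum _ _ _, ← Finset.mul_sum]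
        refine mul_le_mul_of_nonneg_left ?_ (Nat.cast_nonneg _)
        refine (Finset.abs_sum_le_sum_abs _ _).trans (Finset.sum_le_sum fun d _ => ?_)
        exact Finset.abs_sum_le_sum_abs _ _
    _ ≤ _ := Finset.sum_le_sum fun d hd => Finset.sum_le_sum fun e he => key d hd e he
    _ ≤ _ := sum_abs_moebius_mul_le hF i j fun _ => hB
    _ = _ := by rw [Finset.sum_const, card_monicDeg, nsmul_eq_mul, Nat.cast_pow]

open Classical in
lemma sum_monicLE_not_isCoprime_le {e : k[X]} (he : e.Monic) (m : ℕ) :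
    ∑ d ∈ monicLE k m, (if IsCoprime d e then 0 else ((Fintype.card k : ℝ) ^ d.natDegree)⁻¹) ≤
      (m + 1) * (2 ^ e.natDegree / Fintype.card k) := by
  have hq : (0 : ℝ) < Fintype.card k := by exact_mod_cast Fintype.card_pos
  have hcard : ((m : ℝ) + 1) * (2 ^ e.natDegree / Fintype.card k) =
      (Finset.range (m + 1)).card • (2 ^ e.natDegree / Fintype.card k : ℝ) := by simp
  rw [sum_monicLE, hcard]
  refine Finset.sum_le_card_nsmul _ _ _ fun a _ => ?_
  have h := card_monicDeg_not_isCoprime_mul_le he a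
  calc _ = ∑ d ∈ (monicDeg k a).filter (fun d => ¬ IsCoprime d e),
        ((Fintype.card k : ℝ) ^ a)⁻¹ := by
        rw [Finset.sum_filter]
        refine Finset.sum_congr rfl fun d hd => ?_
        rw [(mem_monicDeg.1 hd).2]
        split_ifs <;> simp_all
    _ ≤ _ := by
        rw [Finset.sum_const, nsmul_eq_mul, le_div_iff₀ hq, mul_right_comm,
          mul_inv_le_iff₀ (by positivity)]
        exact_mod_cast h

/-- The correlation of two truncated divisor sums. -/
theorem abs_sum_truncSum_mul_truncSum_sub_le {F : k[X]} {N : ℕ} (hF : F ∈ monicDeg k (N + 1))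
    {i j : ℕ} (hij : i + j ≤ N) :
    |∑ g ∈ monicDeg k N, (truncSum g i : ℝ) * truncSum (F - g) j -
        (if i = 0 then 1 else 0) * (if j = 0 then 1 else 0) * (Fintype.card k : ℝ) ^ N| ≤
      (2 ^ (3 * N + 2) + (i + 1) * (j + 1) * 2 ^ j) *
        ((Fintype.card k : ℝ) ^ N / Fintype.card k) := by
  classical
  have hq : (0 : ℝ) < Fintype.card k := by exact_mod_cast Fintype.card_pos
  set q : ℝ := (Fintype.card k : ℝ) with hqdef
  have key : ∀ d ∈ monicLE k i, ∀ e ∈ monicLE k j,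
      |(moebius d : ℝ) * moebius e * ∑ g ∈ commonMultiples F N d e, 1 -
        moebius d / q ^ d.natDegree * (moebius e / q ^ e.natDegree) * q ^ N| ≤
      |(moebius d : ℝ)| * |(moebius e : ℝ)| *
          (∑ g ∈ commonMultiples F N d e, if IsCoprime g F then 0 else 1) +
        (q ^ e.natDegree)⁻¹ * (if IsCoprime d e then 0 else (q ^ d.natDegree)⁻¹) * q ^ N := by
    intro d hd e he
    obtain ⟨hd, hdi⟩ := mem_monicLE.1 hd
    obtain ⟨he, hej⟩ := mem_monicLE.1 he
    have hμ : ∀ f : k[X], |(moebius f : ℝ)| ≤ 1 := fun f => by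
      rcases moebius_eq f with h | h | h <;> simp [h]
    by_cases hde : IsCoprime d e
    · have h1 : ∑ g ∈ commonMultiples F N d e, (1 : ℝ) =
          q ^ N / (q ^ d.natDegree * q ^ e.natDegree) := by
        rw [Finset.sum_const, nsmul_eq_mul, mul_one, card_commonMultiples hd he hde (by omega),
          Nat.cast_pow, pow_sub₀ _ hq.ne' (by omega), ← div_eq_mul_inv, pow_add]
      rw [h1]
      have : (moebius d : ℝ) * moebius e * (q ^ N / (q ^ d.natDegree * q ^ e.natDegree)) -
        moebius d / q ^ d.natDegree * (moebius e / q ^ e.natDegree) * q ^ N = 0 := by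
        field_simp
        ring
      rw [this, abs_zero]
      have : (0 : ℝ) ≤ ∑ g ∈ commonMultiples F N d e, if IsCoprime g F then 0 else 1 :=
        Finset.sum_nonneg fun g _ => by split_ifs <;> norm_num
      simp only [hde, if_true]
      positivity
    · have h1 : ∑ g ∈ commonMultiples F N d e, (if IsCoprime g F then (0 : ℝ) else 1) =
          ∑ g ∈ commonMultiples F N d e, 1 := by
        refine Finset.sum_congr rfl fun g hg => if_neg fun hc => hde ?_
        obtain ⟨-, h1, h2⟩ := mem_commonMultiples.1 hg
        have : IsCoprime g (F - g) := by
          have := hc.add_mul_left_right (-1)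
          rwa [mul_neg_one, ← sub_eq_add_neg] at this
        exact (this.of_isCoprime_of_dvd_left h1).of_isCoprime_of_dvd_right h2
      rw [h1, if_neg hde]
      refine (abs_sub _ _).trans (add_le_add ?_ ?_)
      · rw [abs_mul, abs_mul, Finset.abs_sum_of_nonneg fun _ _ => zero_le_one]
      · rw [abs_mul, abs_of_pos (show 0 < q ^ N by positivity), abs_mul, abs_div, abs_div,
          abs_of_pos (show 0 < q ^ d.natDegree by positivity),
          abs_of_pos (show 0 < q ^ e.natDegree by positivity), mul_comm (q ^ e.natDegree)⁻¹]
        refine mul_le_mul_of_nonneg_right ?_ (by positivity)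
        rw [div_eq_mul_inv, div_eq_mul_inv]
        exact mul_le_mul (mul_le_of_le_one_left (by positivity) (hμ d))
          (mul_le_of_le_one_left (by positivity) (hμ e)) (by positivity) (by positivity)
  have h0 := sum_truncSum_mul_truncSum hF i j fun _ => 1
  simp only [mul_one] at h0
  rw [h0, ← sum_monicLE_moebius_div (k := k) i, ← sum_monicLE_moebius_div (k := k) j,
    Finset.sum_mul_sum, Finset.sum_mul, ← Finset.sum_sub_distrib]
  simp only [Finset.sum_mul, ← Finset.sum_sub_distrib, ← hqdef]
  refine (Finset.abs_sum_le_sum_abs _ _).trans ((Finset.sum_le_sum fun d hd =>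
    (Finset.abs_sum_le_sum_abs _ _).trans (Finset.sum_le_sum fun e he => key d hd e he)).trans ?_)
  simp only [Finset.sum_add_distrib]
  rw [add_mul]
  refine add_le_add ?_ ?_
  · refine (sum_abs_moebius_mul_le hF i j fun g => ?_).trans ?_
    · split_ifs <;> norm_num
    have hFm := mem_monicDeg.1 hF
    have h := card_monicDeg_not_isCoprime_mul_le hFm.1 N
    rw [hFm.2] at h
    have h' : ∑ g ∈ monicDeg k N, (if IsCoprime g F then (0 : ℝ) else 1) =
        ((monicDeg k N).filter fun g => ¬ IsCoprime g F).card := by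
      rw [Finset.card_filter, Nat.cast_sum]
      refine Finset.sum_congr rfl fun g _ => ?_
      split_ifs <;> simp_all
    rw [h', show 3 * N + 2 = (2 * N + 1) + (N + 1) by ring, pow_add _ (2 * N + 1), mul_assoc]
    refine mul_le_mul_of_nonneg_left ?_ (by positivity)
    rw [← mul_div_assoc, le_div_iff₀ hq, hqdef]
    exact_mod_cast h
  · rw [Finset.sum_comm]
    simp only [← Finset.sum_mul, ← Finset.mul_sum]
    have hr : ((i : ℝ) + 1) * (j + 1) * 2 ^ j * (q ^ N / q) =
        (j + 1) * ((i + 1) * (2 ^ j / q)) * q ^ N := by ring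
    rw [hr]
    refine mul_le_mul_of_nonneg_right ?_ (by positivity)
    calc _ ≤ ∑ e ∈ monicLE k j, (q ^ e.natDegree)⁻¹ * ((i + 1) * (2 ^ j / q)) := by
          refine Finset.sum_le_sum fun e he => mul_le_mul_of_nonneg_left ?_ (by positivity)
          obtain ⟨he, hej⟩ := mem_monicLE.1 he
          refine (sum_monicLE_not_isCoprime_le he i).trans ?_
          gcongr
          norm_num
      _ = (j + 1) * ((i + 1) * (2 ^ j / q)) := by
          rw [← Finset.sum_mul, sum_monicLE]
          congr 1
          rw [Finset.sum_congr rfl fun a _ => (Finset.sum_congr rfl fun e he => by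
            rw [(mem_monicDeg.1 he).2] : _ = ∑ e ∈ monicDeg k a, (q ^ a)⁻¹)]
          simp only [Finset.sum_const, card_monicDeg, nsmul_eq_mul, Nat.cast_pow, ← hqdef]
          rw [Finset.sum_congr rfl fun a _ => mul_inv_cancel₀ (pow_ne_zero a hq.ne')]
          simp

end Averaging

section Goldbach

variable {k : Type*} [Field k] [Fintype k]

/-- The sum of the truncated divisor sums at the levels below `A`. -/
noncomputable def truncSumBelow (f : k[X]) (A : ℕ) : ℤ := ∑ i ∈ Finset.range A, truncSum f i

open Classical in
lemma natDegree_indicator_eq {f : k[X]} (hf : f.Monic) (hs : Squarefree f) (h1 : f ≠ 1) :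
    (if Irreducible f then (f.natDegree : ℤ) else 0) =
      truncSumBelow f ((f.natDegree + 1) / 2) -
        moebius f * truncSumBelow f (f.natDegree / 2) := by
  rw [← sum_truncSum hf hs h1, truncSumBelow, truncSumBelow, sub_eq_add_neg, ← neg_mul,
    Finset.mul_sum]
  conv_lhs => rw [show f.natDegree = (f.natDegree + 1) / 2 + f.natDegree / 2 by omega,
    Finset.sum_range_add]
  congr 1
  rw [← Finset.sum_range_reflect]
  refine Finset.sum_congr rfl fun i hi => truncSum_reflect hf hs ?_
  have := Finset.mem_range.1 hi
  omega

lemma truncSumBelow_sub_eq {f : k[X]} (hf : f.Monic) (hs : Squarefree f) :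
    truncSumBelow f ((f.natDegree + 1) / 2) - truncSumBelow f (f.natDegree / 2) =
      -moebius f *
        (truncSumBelow f ((f.natDegree + 1) / 2) - truncSumBelow f (f.natDegree / 2)) := by
  rcases Nat.even_or_odd' f.natDegree with ⟨m, hm | hm⟩
  · rw [show (f.natDegree + 1) / 2 = f.natDegree / 2 by omega]
    ring
  · rw [show (f.natDegree + 1) / 2 = f.natDegree / 2 + 1 by omega, truncSumBelow,
      Finset.sum_range_succ, ← truncSumBelow, add_sub_cancel_left]
    exact truncSum_reflect hf hs (by omega)

lemma abs_truncSumBelow_le {f : k[X]} (hf : f.Monic) (A : ℕ) :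
    |(truncSumBelow f A : ℝ)| ≤ A * 2 ^ f.natDegree := by
  have h : |truncSumBelow f A| ≤ A * 2 ^ f.natDegree := by
    refine (Finset.abs_sum_le_sum_abs _ _).trans
      ((Finset.sum_le_card_nsmul _ _ _ fun i _ => abs_truncSum_le hf i).trans_eq ?_)
    simp
  exact_mod_cast h

lemma abs_sum_truncSumBelow_le {F : k[X]} {N A B : ℕ} {φ : k[X] → ℝ} {c M : ℝ}
    (h : ∀ i < A, ∀ j < B,
      |∑ g ∈ monicDeg k N, (truncSum g i : ℝ) * truncSum (F - g) j * φ g -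
        (if i = 0 then 1 else 0) * (if j = 0 then 1 else 0) * c| ≤ M) (hA : 0 < A) (hB : 0 < B) :
    |∑ g ∈ monicDeg k N, (truncSumBelow g A : ℝ) * truncSumBelow (F - g) B * φ g - c| ≤
      A * B * M := by
  have h1 : ∑ g ∈ monicDeg k N, (truncSumBelow g A : ℝ) * truncSumBelow (F - g) B * φ g =
      ∑ i ∈ Finset.range A, ∑ j ∈ Finset.range B,
        ∑ g ∈ monicDeg k N, (truncSum g i : ℝ) * truncSum (F - g) j * φ g := by
    rw [Finset.sum_congr rfl fun i _ => Finset.sum_comm, Finset.sum_comm]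
    refine Finset.sum_congr rfl fun g _ => ?_
    rw [truncSumBelow, truncSumBelow, Int.cast_sum, Int.cast_sum, Finset.sum_mul_sum,
      Finset.sum_mul]
    exact Finset.sum_congr rfl fun i _ => Finset.sum_mul _ _ _
  have h2 : c = ∑ i ∈ Finset.range A, ∑ j ∈ Finset.range B,
      (if i = 0 then 1 else 0) * (if j = 0 then 1 else 0) * c := by
    simp [hA, hB]
  rw [h1, h2]
  simp only [← Finset.sum_sub_distrib]
  calc _ ≤ ∑ i ∈ Finset.range A, ∑ j ∈ Finset.range B, M := by
        refine (Finset.abs_sum_le_sum_abs _ _).trans (Finset.sum_le_sum fun i hi => ?_)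
        refine (Finset.abs_sum_le_sum_abs _ _).trans (Finset.sum_le_sum fun j hj => ?_)
        exact h i (Finset.mem_range.1 hi) j (Finset.mem_range.1 hj)
    _ = _ := by
        simp
        ring

/-- The expression in truncated divisor sums which detects Goldbach representations. -/
noncomputable def goldbachWeight (F : k[X]) (N : ℕ) (g : k[X]) : ℝ :=
  truncSumBelow g ((N + 1) / 2) * truncSumBelow (F - g) ((N + 2) / 2)
    - truncSumBelow g (N / 2) * truncSumBelow (F - g) ((N + 1) / 2) * moebius g
    - truncSumBelow g ((N + 1) / 2) * truncSumBelow (F - g) ((N + 1) / 2) * moebius (F - g)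
    + truncSumBelow g (N / 2) * truncSumBelow (F - g) ((N + 2) / 2) *
        (moebius g * moebius (F - g) : ℤ)

open Classical in
lemma goldbachWeight_eq {F g : k[X]} {N : ℕ} (hN : 1 ≤ N) (hF : F ∈ monicDeg k (N + 1))
    (hg : g ∈ monicDeg k N) (hs : Squarefree g) (hs' : Squarefree (F - g)) :
    goldbachWeight F N g =
      if Irreducible g ∧ Irreducible (F - g) then (N : ℝ) * (N + 1) else 0 := by
  obtain ⟨hf, hfN⟩ := mem_monicDeg.1 (sub_mem_monicDeg hF hg)
  obtain ⟨hg, hgN⟩ := mem_monicDeg.1 hg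
  have h1 := natDegree_indicator_eq hg hs (by rintro rfl; simp at hgN; omega)
  have h2 := natDegree_indicator_eq hf hs' (by intro h; rw [h, natDegree_one] at hfN; omega)
  have h3 := truncSumBelow_sub_eq hf hs'
  rw [hgN] at h1
  rw [hfN] at h2 h3
  have h : goldbachWeight F N g = ((if Irreducible g then (N : ℤ) else 0) *
      (if Irreducible (F - g) then ((N + 1 : ℕ) : ℤ) else 0) : ℤ) := by
    rw [h1, h2, goldbachWeight]
    norm_cast
    linear_combination moebius g * truncSumBelow g (N / 2) * h3
  rw [h]
  by_cases hi : Irreducible g <;> by_cases hi' : Irreducible (F - g) <;> simp [hi, hi']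

lemma abs_goldbachWeight_le {F g : k[X]} {N : ℕ} (hN : 1 ≤ N) (hF : F ∈ monicDeg k (N + 1))
    (hg : g ∈ monicDeg k N) :
    |goldbachWeight F N g| ≤ 4 * ((N + 1) ^ 2 * 2 ^ (2 * N + 1)) := by
  obtain ⟨hf, hfN⟩ := mem_monicDeg.1 (sub_mem_monicDeg hF hg)
  obtain ⟨hg, hgN⟩ := mem_monicDeg.1 hg
  have hμ : ∀ f : k[X], |(moebius f : ℝ)| ≤ 1 := fun f => by
    rcases moebius_eq f with h | h | h <;> simp [h]
  have hT : ∀ A B : ℕ, A ≤ N + 1 → B ≤ N + 1 →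
      |(truncSumBelow g A : ℝ) * truncSumBelow (F - g) B| ≤ (N + 1) ^ 2 * 2 ^ (2 * N + 1) := by
    intro A B hA hB
    have h1 := abs_truncSumBelow_le hg A
    have h2 := abs_truncSumBelow_le hf B
    rw [hgN] at h1
    rw [hfN] at h2
    have hA' : (A : ℝ) ≤ N + 1 := by exact_mod_cast hA
    have hB' : (B : ℝ) ≤ N + 1 := by exact_mod_cast hB
    rw [abs_mul]
    calc _ ≤ (A * 2 ^ N : ℝ) * (B * 2 ^ (N + 1)) := by gcongr
      _ ≤ ((N + 1) * 2 ^ N : ℝ) * ((N + 1) * 2 ^ (N + 1)) := by gcongr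
      _ = _ := by ring
  have hm : ∀ x y : ℝ, |y| ≤ 1 → |x * y| ≤ |x| := fun x y hy => by
    rw [abs_mul]
    exact mul_le_of_le_one_right (abs_nonneg x) hy
  have hμμ : |((moebius g * moebius (F - g) : ℤ) : ℝ)| ≤ 1 := by
    rw [Int.cast_mul]
    exact (hm _ _ (hμ _)).trans (hμ g)
  have t1 := hT ((N + 1) / 2) ((N + 2) / 2) (by omega) (by omega)
  have t2 := (hm _ _ (hμ g)).trans (hT (N / 2) ((N + 1) / 2) (by omega) (by omega))
  have t3 := (hm _ _ (hμ (F - g))).trans (hT ((N + 1) / 2) ((N + 1) / 2) (by omega) (by omega))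
  have t4 := (hm _ _ hμμ).trans (hT (N / 2) ((N + 2) / 2) (by omega) (by omega))
  rw [goldbachWeight]
  rw [abs_le] at t1 t2 t3 t4 ⊢
  constructor <;> linarith [t1.1, t1.2, t2.1, t2.2, t3.1, t3.2, t4.1, t4.2]

open Classical in
lemma card_not_squarefree_mul_le (hk : Odd (Fintype.card k)) {F : k[X]} {N : ℕ} (hN : 1 ≤ N)
    (hNk : N ≤ Fintype.card k) (hF : F ∈ monicDeg k (N + 1)) :
    (((monicDeg k N).filter fun g => ¬ (Squarefree g ∧ Squarefree (F - g))).card : ℝ) ≤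
      4 * (N + 1) * ((Fintype.card k : ℝ) ^ N / Fintype.card k) := by
  have hq : (0 : ℝ) < Fintype.card k := by exact_mod_cast Fintype.card_pos
  obtain ⟨E, hE, -, hED⟩ := exists_squarefree_natDegree_eq (k := k) (D := N - 1) squarefree_one
    (by simp) (by omega)
  have hline := card_mul_sum_eq_sum_line (monicDeg k N) E
    (fun g hg s => add_C_mul_mem_monicDeg (by omega) hg s)
    (fun g => if Squarefree g ∧ Squarefree (F - g) then 0 else 1)
  have hcard : (((monicDeg k N).filter fun g => ¬ (Squarefree g ∧ Squarefree (F - g))).card : ℝ) =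
      ∑ g ∈ monicDeg k N, if Squarefree g ∧ Squarefree (F - g) then 0 else 1 := by
    rw [Finset.card_filter, Nat.cast_sum]
    refine Finset.sum_congr rfl fun g _ => ?_
    split_ifs <;> simp_all
  rw [hcard, ← mul_div_assoc, le_div_iff₀ hq, mul_comm, hline]
  refine (Finset.sum_le_card_nsmul _ _ (4 * (N + 1) : ℝ) fun g hg => ?_).trans_eq ?_
  swap
  · rw [card_monicDeg, nsmul_eq_mul, Nat.cast_pow, mul_comm]
  obtain ⟨hf, hfN⟩ := mem_monicDeg.1 (sub_mem_monicDeg hF hg)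
  obtain ⟨hg, hgN⟩ := mem_monicDeg.1 hg
  have h1 := card_not_squarefree_add_C_mul_le hk hg hE (δ := 1) (by simp) (by omega)
  have h2 := card_not_squarefree_add_C_mul_le hk hf (E := -E) (fun x hx => hE x (dvd_neg.1 hx))
    (two_ne_zero_of_odd_card hk) (by rw [natDegree_neg]; omega)
  calc _ ≤ ∑ s : k, ((if ¬ Squarefree (g + C s * E) then (1 : ℝ) else 0) +
        if ¬ Squarefree (F - g + C s * -E) then 1 else 0) := by
        refine Finset.sum_le_sum fun s _ => ?_
        rw [mul_neg, ← sub_eq_add_neg, sub_sub]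
        by_cases h : Squarefree (g + C s * E) <;>
        by_cases h' : Squarefree (F - (g + C s * E)) <;> simp [h, h']
    _ ≤ 2 * N + 2 * (N + 1) := by
        rw [Finset.sum_add_distrib, Finset.sum_boole, Finset.sum_boole]
        rw [hgN] at h1
        rw [hfN] at h2
        exact add_le_add (by exact_mod_cast h1) (by exact_mod_cast h2)
    _ ≤ _ := by linarith

lemma abs_sum_truncSumBelow_mul_le {F : k[X]} {N A B D : ℕ} (hF : F ∈ monicDeg k (N + 1))
    (hA : A ≤ N + 1) (hB : B ≤ N + 1) (hAB : 0 < A → 0 < B → A + B ≤ D + 2 ∧ D < N)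
    (hN : N ≤ Fintype.card k) {φ : k[X] → ℝ} {M : ℝ} (hM : 0 ≤ M)
    (hφ : 0 < A → ∀ E : k[X], Squarefree E → E.natDegree = D → ∀ g ∈ monicDeg k N,
      |∑ s : k, φ (g + C s * E)| ≤ M) :
    |∑ g ∈ monicDeg k N, (truncSumBelow g A : ℝ) * truncSumBelow (F - g) B * φ g| ≤
      (N + 1) ^ 2 * (2 ^ (2 * N + 1) * M * ((Fintype.card k : ℝ) ^ N / Fintype.card k)) := by
  have hq : (0 : ℝ) < Fintype.card k := by exact_mod_cast Fintype.card_pos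
  rcases Nat.eq_zero_or_pos A with rfl | hA0
  · simp only [truncSumBelow, Finset.range_zero, Finset.sum_empty, Int.cast_zero, zero_mul,
      Finset.sum_const_zero, abs_zero]
    positivity
  rcases Nat.eq_zero_or_pos B with rfl | hB0
  · simp only [truncSumBelow, Finset.range_zero, Finset.sum_empty, Int.cast_zero, zero_mul,
      mul_zero, Finset.sum_const_zero, abs_zero]
    positivity
  obtain ⟨hABD, hDN⟩ := hAB hA0 hB0
  have h := abs_sum_truncSumBelow_le (F := F) (N := N) (A := A) (B := B) (φ := φ) (c := 0)
    (M := 2 ^ (2 * N + 1) * M * ((Fintype.card k : ℝ) ^ N / Fintype.card k))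
    (fun i hi j hj => by
      rw [mul_zero, sub_zero, ← mul_div_assoc, le_div_iff₀ hq, mul_comm]
      refine (card_mul_abs_sum_truncSum_le hF (by omega) hDN (by omega) (hφ hA0)).trans_eq ?_
      ring) hA0 hB0
  rw [sub_zero] at h
  refine h.trans (mul_le_mul_of_nonneg_right ?_ (by positivity))
  rw [pow_two]
  exact mul_le_mul (by exact_mod_cast hA) (by exact_mod_cast hB) (by positivity) (by positivity)

lemma abs_sum_goldbachWeight_sub_le (hk : Odd (Fintype.card k)) {F : k[X]} {N : ℕ} (hN : 1 ≤ N)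
    (hNk : 32 * (N + 1) ≤ Fintype.card k) (hF : F ∈ monicDeg k (N + 1)) :
    |∑ g ∈ monicDeg k N, goldbachWeight F N g - (Fintype.card k : ℝ) ^ N| ≤
      (N + 1) ^ 2 * (2 ^ (3 * N + 3) + 3 * (2 ^ (2 * N + 1) *
        (108 * (N + 1) * √(Fintype.card k)))) * ((Fintype.card k : ℝ) ^ N / Fintype.card k) := by
  have hq : (0 : ℝ) < Fintype.card k := by exact_mod_cast Fintype.card_pos
  have hr := Real.sqrt_nonneg (Fintype.card k : ℝ)
  set q : ℝ := (Fintype.card k : ℝ) with hqdef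
  set M : ℝ := 108 * (N + 1) * √q with hMdef
  have hM : 0 ≤ M := by positivity
  have s1 := abs_sum_truncSumBelow_le (F := F) (N := N) (A := (N + 1) / 2) (B := (N + 2) / 2)
    (φ := fun _ => 1) (c := q ^ N) (M := 2 ^ (3 * N + 3) * (q ^ N / q))
    (fun i hi j hj => by
      simp only [mul_one]
      refine (abs_sum_truncSum_mul_truncSum_sub_le hF (by omega)).trans ?_
      refine mul_le_mul_of_nonneg_right ?_ (by positivity)
      have h1 : ((i + 1) * (j + 1) * 2 ^ j : ℕ) ≤ 2 ^ (3 * N + 2) := by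
        calc (i + 1) * (j + 1) * 2 ^ j ≤ 2 ^ i * 2 ^ j * 2 ^ j := by
              gcongr <;> exact Nat.lt_two_pow_self
          _ = 2 ^ (i + j + j) := by ring
          _ ≤ _ := Nat.pow_le_pow_right (by norm_num) (by omega)
      have h2 : ((i : ℝ) + 1) * (j + 1) * 2 ^ j ≤ 2 ^ (3 * N + 2) := by exact_mod_cast h1
      rw [pow_succ _ (3 * N + 2)]
      linarith) (by omega) (by omega)
  have s2 := abs_sum_truncSumBelow_mul_le (A := N / 2) (B := (N + 1) / 2) (D := N - 2) hF
    (by omega) (by omega) (by omega) (by omega) (φ := fun g => (moebius g : ℝ)) hM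
    (fun hA E hE hED g hg => by
      obtain ⟨hg, hgN⟩ := mem_monicDeg.1 hg
      refine (abs_sum_moebius_le hk (by omega) hg hE (by omega) (by omega)).trans ?_
      rw [hgN, hMdef]
      gcongr ?_ * √q
      linarith [(Nat.cast_nonneg N : (0 : ℝ) ≤ N)])
  have s3 := abs_sum_truncSumBelow_mul_le (A := (N + 1) / 2) (B := (N + 1) / 2) (D := N - 1) hF
    (by omega) (by omega) (by omega) (by omega) (φ := fun g => (moebius (F - g) : ℝ)) hM
    (fun hA E hE hED g hg => by
      obtain ⟨hf, hfN⟩ := mem_monicDeg.1 (sub_mem_monicDeg hF hg)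
      have := abs_sum_moebius_le hk (by omega) hf (E := -E) (fun x hx => hE x (dvd_neg.1 hx))
        (by rw [natDegree_neg]; omega) (by omega)
      simp only [mul_neg, ← sub_eq_add_neg, sub_sub] at this
      refine this.trans ?_
      rw [hfN, hMdef]
      gcongr ?_ * √q
      push_cast
      linarith [(Nat.cast_nonneg N : (0 : ℝ) ≤ N)])
  have s4 := abs_sum_truncSumBelow_mul_le (A := N / 2) (B := (N + 2) / 2) (D := N - 1) hF
    (by omega) (by omega) (by omega) (by omega)
    (φ := fun g => ((moebius g * moebius (F - g) : ℤ) : ℝ)) hM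
    (fun hA E hE hED g hg => by
      obtain ⟨hf, hfN⟩ := mem_monicDeg.1 (sub_mem_monicDeg hF hg)
      obtain ⟨hg, hgN⟩ := mem_monicDeg.1 hg
      have := abs_sum_moebius_mul_moebius_le hk (by omega) hg hf hE (by omega) (by omega)
        (by omega)
      simp only [sub_sub] at this
      refine this.trans_eq ?_
      rw [hfN, hMdef]
      push_cast
      rfl)
  have s1' : ((((N + 1) / 2 : ℕ) : ℝ) * ((N + 2) / 2 : ℕ)) * (2 ^ (3 * N + 3) * (q ^ N / q)) ≤
      (N + 1) ^ 2 * (2 ^ (3 * N + 3) * (q ^ N / q)) := by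
    refine mul_le_mul_of_nonneg_right ?_ (by positivity)
    have : (N + 1) / 2 * ((N + 2) / 2) ≤ (N + 1) ^ 2 := by
      rw [pow_two]
      exact Nat.mul_le_mul (by omega) (by omega)
    exact_mod_cast this
  simp only [mul_one] at s1
  simp only [← hqdef] at s2 s3 s4
  simp only [goldbachWeight, Finset.sum_add_distrib, Finset.sum_sub_distrib]
  rw [abs_le] at s1 s2 s3 s4 ⊢
  constructor <;> linarith [s1.1, s1.2, s2.1, s2.2, s3.1, s3.2, s4.1, s4.2]

open Classical in
/-- The number of Goldbach representations, with an explicit error term. -/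
theorem abs_card_goldbach_mul_sub_le (hk : Odd (Fintype.card k)) {F : k[X]} {N : ℕ} (hN : 1 ≤ N)
    (hNk : 32 * (N + 1) ≤ Fintype.card k) (hF : F ∈ monicDeg k (N + 1)) :
    |(((monicDeg k N).filter fun g => Irreducible g ∧ Irreducible (F - g)).card : ℝ) *
        (N * (N + 1)) - (Fintype.card k : ℝ) ^ N| ≤
      341 * (N + 1) ^ 3 * 8 ^ (N + 1) *
        (√(Fintype.card k) * ((Fintype.card k : ℝ) ^ N / Fintype.card k)) := by
  have h1 := abs_sum_goldbachWeight_sub_le hk hN hNk hF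
  have hbad := card_not_squarefree_mul_le hk hN (by omega) hF
  have h2 : |(((monicDeg k N).filter fun g => Irreducible g ∧ Irreducible (F - g)).card : ℝ) *
      (N * (N + 1)) - ∑ g ∈ monicDeg k N, goldbachWeight F N g| ≤
      4 * (N + 1) * ((Fintype.card k : ℝ) ^ N / Fintype.card k) *
        (4 * ((N + 1) ^ 2 * 2 ^ (2 * N + 1))) := by
    rw [← nsmul_eq_mul, ← Finset.sum_const, Finset.sum_filter, ← Finset.sum_sub_distrib]
    refine (Finset.abs_sum_le_sum_abs _ _).trans ?_
    calc _ ≤ ∑ g ∈ monicDeg k N, if ¬ (Squarefree g ∧ Squarefree (F - g)) then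
          (4 * ((N + 1) ^ 2 * 2 ^ (2 * N + 1)) : ℝ) else 0 := by
          refine Finset.sum_le_sum fun g hg => ?_
          by_cases hs : Squarefree g ∧ Squarefree (F - g)
          · rw [goldbachWeight_eq hN hF hg hs.1 hs.2, sub_self, abs_zero, if_neg (not_not.2 hs)]
          · rw [if_pos hs, if_neg fun h => hs ⟨h.1.squarefree, h.2.squarefree⟩, zero_sub, abs_neg]
            exact abs_goldbachWeight_le hN hF hg
      _ ≤ _ := by
          rw [← Finset.sum_filter, Finset.sum_const, nsmul_eq_mul]
          exact mul_le_mul_of_nonneg_right hbad (by positivity)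
  have hr : 1 ≤ √(Fintype.card k : ℝ) :=
    Real.one_le_sqrt.2 (by exact_mod_cast Fintype.card_pos)
  have hN0 : (0 : ℝ) ≤ N := Nat.cast_nonneg N
  set c : ℝ := (Fintype.card k : ℝ) ^ N / Fintype.card k with hc
  have hc0 : 0 ≤ c := by positivity
  set r : ℝ := √(Fintype.card k : ℝ)
  have h4 : (2 : ℝ) ^ (2 * N + 1) ≤ 8 ^ (N + 1) := by
    rw [show (8 : ℝ) = 2 ^ 3 by norm_num, ← pow_mul]
    exact pow_le_pow_right₀ (by norm_num) (by omega)
  have h8 : (2 : ℝ) ^ (3 * N + 3) = 8 ^ (N + 1) := by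
    rw [show (8 : ℝ) = 2 ^ 3 by norm_num, ← pow_mul]
    ring
  rw [h8] at h1
  set T : ℝ := 8 ^ (N + 1)
  have hT : 0 < T := by positivity
  refine (abs_sub_le _ _ _).trans ((add_le_add h2 h1).trans ?_)
  set n : ℝ := (N : ℝ) + 1
  have hn : 1 ≤ n := by simp [n]
  calc _ ≤ 4 * n * c * (4 * (n ^ 2 * T)) + n ^ 2 * (T + 3 * (T * (108 * n * r))) * c := by
        gcongr
    _ = T * n ^ 2 * c * (16 * n + 1 + 324 * (n * r)) := by ring
    _ ≤ T * n ^ 2 * c * (16 * (n * r) + n * r + 324 * (n * r)) := by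
        have : n ≤ n * r := le_mul_of_one_le_right (by linarith) hr
        gcongr
        linarith
    _ = _ := by ring

end Goldbach

lemma nine_mul_le_choose_add (n : ℕ) : 9 * n ≤ (n + 2).choose 2 + 27 := by
  have h : 2 * (n + 2).choose 2 = (n + 2) * (n + 1) := by
    rw [Nat.choose_two_right, Nat.mul_div_cancel' (Nat.even_mul_pred_self _).two_dvd]
    rfl
  zify at h ⊢
  by_contra! hlt
  have h7 : (n : ℤ) ≤ 7 ∨ (8 : ℤ) ≤ n := by omega
  rcases h7 with h7 | h7 <;> nlinarith

lemma natCard_goldbach_eq {k : Type*} [Field k] [Fintype k] {F : k[X]} {N : ℕ}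
    (hF : F ∈ monicDeg k (N + 1)) [DecidablePred fun g => Irreducible g ∧ Irreducible (F - g)] :
    Nat.card {g : k[X] // g.Monic ∧ Irreducible g ∧ g.natDegree = N ∧ (F - g).Monic ∧
      Irreducible (F - g)} =
    ((monicDeg k N).filter fun g => Irreducible g ∧ Irreducible (F - g)).card := by
  rw [← Nat.card_eq_finsetCard]
  refine Nat.card_congr (Equiv.subtypeEquivRight fun g => ?_)
  rw [Finset.mem_filter]
  constructor
  · rintro ⟨h1, h2, h3, -, h5⟩
    exact ⟨mem_monicDeg.2 ⟨h1, h3⟩, h2, h5⟩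
  · rintro ⟨h, h2, h5⟩
    exact ⟨(mem_monicDeg.1 h).1, h2, (mem_monicDeg.1 h).2,
      (mem_monicDeg.1 (sub_mem_monicDeg hF h)).1, h5⟩

/-- **Asymptotic for the Goldbach count.**  For every `ε > 0` there is `K > 0` such that for
every finite field `F_q` of odd order `q`, every `n ≥ 2` and every monic `F ∈ F_q[t]` of
degree `n`, if `q ≥ K·n³·2^(C(n+2,2))` then `|R(F;q)·n(n−1)/q^(n−1) − 1| < ε`;
i.e. `R(F;q) ∼ q^(n−1)/(n(n−1))` uniformly in `F` whenever `q/(n³·2^(C(n+2,2))) → ∞`. -/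
theorem goldbach_count_asymptotic :
    ∀ ε : ℝ, 0 < ε → ∃ K : ℝ, 0 < K ∧
      ∀ (Fq : Type) [Field Fq] [Fintype Fq], Odd (Fintype.card Fq) →
      ∀ (n : ℕ), 2 ≤ n → ∀ F : Polynomial Fq, F.Monic → F.natDegree = n →
      (Fintype.card Fq : ℝ) ≥ K * n ^ 3 * 2 ^ (Nat.choose (n + 2) 2) →
      |(Nat.card {g : Polynomial Fq //
            g.Monic ∧ Irreducible g ∧ g.natDegree = n - 1 ∧
            (F - g).Monic ∧ Irreducible (F - g)} : ℝ)
          * (n * (n - 1)) / (Fintype.card Fq : ℝ) ^ (n - 1) - 1| < ε := by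
  intro ε hε
  refine ⟨32 + 341 ^ 2 * 2 ^ 27 / ε ^ 2, by positivity, ?_⟩
  intro Fq _ _ hodd n hn F hF hFn hq
  classical
  obtain ⟨N, rfl⟩ : ∃ N, n = N + 1 := ⟨n - 1, by omega⟩
  have hFm : F ∈ monicDeg Fq (N + 1) := mem_monicDeg.2 ⟨hF, hFn⟩
  rw [Nat.add_sub_cancel, natCard_goldbach_eq hFm]
  have hq0 : (0 : ℝ) < Fintype.card Fq := by exact_mod_cast Fintype.card_pos
  have hn1 : (1 : ℝ) ≤ ((N + 1 : ℕ) : ℝ) := by exact_mod_cast (by omega : 1 ≤ N + 1)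
  have hpow : (1 : ℝ) ≤ 2 ^ (N + 1 + 2).choose 2 := one_le_pow₀ (by norm_num)
  have hn3 : ((N + 1 : ℕ) : ℝ) ≤ ((N + 1 : ℕ) : ℝ) ^ 3 := le_self_pow₀ hn1 (by norm_num)
  have h32 : 32 * (N + 1) ≤ Fintype.card Fq := by
    have : 32 * ((N + 1 : ℕ) : ℝ) ≤ Fintype.card Fq := by
      refine le_trans ?_ hq
      calc 32 * ((N + 1 : ℕ) : ℝ) ≤ 32 * ((N + 1 : ℕ) : ℝ) ^ 3 * 1 := by linarith
        _ ≤ _ := by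
          gcongr
          exact le_add_of_nonneg_right (by positivity)
    exact_mod_cast this
  have hmain := abs_card_goldbach_mul_sub_le hodd (by omega) h32 hFm
  push_cast at hq hn1 hn3 ⊢
  set q : ℝ := (Fintype.card Fq : ℝ)
  set m : ℝ := (N : ℝ) + 1 with hm
  have hbound : (341 * m ^ 3 * 8 ^ (N + 1)) ^ 2 < ε ^ 2 * q := by
    have h2 : (2 : ℝ) ^ (9 * (N + 1)) ≤ 2 ^ 27 * 2 ^ (N + 1 + 2).choose 2 := by
      rw [← pow_add]
      exact pow_le_pow_right₀ (by norm_num) (by linarith [nine_mul_le_choose_add (N + 1)])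
    have h3 : m ^ 3 * 64 ^ (N + 1) ≤ 2 ^ (9 * (N + 1)) := by
      have : m ≤ 2 ^ (N + 1) := by
        rw [hm]
        exact_mod_cast Nat.lt_two_pow_self.le
      calc m ^ 3 * 64 ^ (N + 1) ≤ (2 ^ (N + 1)) ^ 3 * 64 ^ (N + 1) := by gcongr
        _ = _ := by
          rw [show (64 : ℝ) = 2 ^ 6 by norm_num, ← pow_mul, ← pow_mul, ← pow_add]
          congr 1
          ring
    calc (341 * m ^ 3 * 8 ^ (N + 1)) ^ 2
        = 341 ^ 2 * m ^ 3 * (m ^ 3 * 64 ^ (N + 1)) := by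
          rw [show (64 : ℝ) = 8 ^ 2 by norm_num, ← pow_mul]
          ring
      _ ≤ 341 ^ 2 * m ^ 3 * (2 ^ 27 * 2 ^ (N + 1 + 2).choose 2) :=
          mul_le_mul_of_nonneg_left (h3.trans h2) (by positivity)
      _ = ε ^ 2 * (341 ^ 2 * 2 ^ 27 / ε ^ 2 * m ^ 3 * 2 ^ (N + 1 + 2).choose 2) := by
          field_simp
      _ < ε ^ 2 * ((32 + 341 ^ 2 * 2 ^ 27 / ε ^ 2) * m ^ 3 * 2 ^ (N + 1 + 2).choose 2) := by
          gcongr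
          linarith
      _ ≤ ε ^ 2 * q := by gcongr
  have hlt : 341 * m ^ 3 * 8 ^ (N + 1) < ε * √q := by
    refine lt_of_pow_lt_pow_left₀ 2 (by positivity) ?_
    rwa [mul_pow ε, Real.sq_sqrt hq0.le]
  rw [div_sub_one (by positivity), abs_div, abs_of_pos (show 0 < q ^ N by positivity),
    div_lt_iff₀ (by positivity), hm, add_sub_cancel_right, mul_comm ((N : ℝ) + 1)]
  refine hmain.trans_lt ?_
  calc 341 * m ^ 3 * 8 ^ (N + 1) * (√q * (q ^ N / q))
      < ε * √q * (√q * (q ^ N / q)) := by gcongr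
    _ = ε * (√q * √q) * (q ^ N / q) := by ring
    _ = ε * q ^ N := by
      rw [Real.mul_self_sqrt hq0.le]
      field_simp
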